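/- Let n ≥ 7 and let u : ℝⁿ → (0,∞) be a smooth positive solution of (−Δ)³u = c_n·u^((n+6)/(n−6)) on all of ℝⁿ (equivalently, a positive solution on ℝⁿ \ {0} for which the origin is a removable singularity). Then there exist x₀ ∈ ℝⁿ and ε > 0 such that u(x) = (2ε/(1 + ε²|x − x₀|²))^((n−6)/2) for all x ∈ ℝⁿ; in particular u is radially symmetric about x₀. -/

import Mathlib

noncomputable section

def cst (n : ℕ) : ℝ := ((n:ℝ)-6)*((n:ℝ)-4)*((n:ℝ)-2)*(n:ℝ)*((n:ℝ)+2)*((n:ℝ)+4)/64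

/-- The Euclidean Laplacian Δu(x) = Σᵢ ∂²u/∂xᵢ²(x) on ℝⁿ. -/
def lap {n : ℕ} (u : EuclideanSpace ℝ (Fin n) → ℝ) (x : EuclideanSpace ℝ (Fin n)) : ℝ :=
  ∑ i : Fin n, fderiv ℝ (fun y => fderiv ℝ u y (EuclideanSpace.single i 1)) x
    (EuclideanSpace.single i 1)

open MeasureTheory Set Filter Topology
open scoped ContDiff

namespace Bubble

section calculus
variable {n : ℕ}

local notation "E" => EuclideanSpace ℝ (Fin n)

theorem contDiff_dir {u : E → ℝ} (hu : ContDiff ℝ ∞ u) (v : E) :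
    ContDiff ℝ ∞ (fun y => fderiv ℝ u y v) :=
  (hu.fderiv_right (m := ∞) (by simp)).clm_apply contDiff_const

theorem contDiff_lap {u : E → ℝ} (hu : ContDiff ℝ ∞ u) : ContDiff ℝ ∞ (lap u) := by
  unfold lap
  exact ContDiff.sum fun i _ => contDiff_dir (contDiff_dir hu _) _

theorem hcs_dir {u : E → ℝ} (hu : HasCompactSupport u) (v : E) :
    HasCompactSupport (fun y => fderiv ℝ u y v) :=
  hu.fderiv_apply (𝕜 := ℝ) v

theorem hcs_lap {u : E → ℝ} (hu : HasCompactSupport u) : HasCompactSupport (lap u) := by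
  have : lap u = fun x => ∑ i : Fin n, fderiv ℝ (fun y => fderiv ℝ u y (EuclideanSpace.single i 1)) x
    (EuclideanSpace.single i 1) := rfl
  rw [this]
  have h : ∀ s : Finset (Fin n), HasCompactSupport (fun x => ∑ i ∈ s, fderiv ℝ (fun y => fderiv ℝ u y (EuclideanSpace.single i 1)) x
    (EuclideanSpace.single i 1)) := by
    intro s
    induction s using Finset.induction_on with
    | empty => exact (HasCompactSupport.zero : HasCompactSupport (0 : E → ℝ))
    | insert a s ha ih =>
      simp only [Finset.sum_insert ha]
      exact (hcs_dir (hcs_dir hu _) _).add ih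
  exact h _

theorem ibp1 {a b : E → ℝ} (ha : ContDiff ℝ ∞ a) (hb : ContDiff ℝ ∞ b) (hc : HasCompactSupport b)
    (v : E) : ∫ x, a x * fderiv ℝ b x v = - ∫ x, fderiv ℝ a x v * b x := by
  apply integral_mul_fderiv_eq_neg_fderiv_mul_of_integrable
  · exact ((contDiff_dir ha v).continuous.mul hb.continuous).integrable_of_hasCompactSupport
      (hc.mul_left)
  · exact (ha.continuous.mul (contDiff_dir hb v).continuous).integrable_of_hasCompactSupport
      ((hcs_dir hc v).mul_left)
  · exact (ha.continuous.mul hb.continuous).integrable_of_hasCompactSupport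
      (hc.mul_left)
  · exact fun x _ => ha.differentiable (by simp) x
  · exact fun x _ => hb.differentiable (by simp) x

theorem ibp2 {a b : E → ℝ} (ha : ContDiff ℝ ∞ a) (hb : ContDiff ℝ ∞ b) (hc : HasCompactSupport b) :
    ∫ x, a x * lap b x = ∫ x, lap a x * b x := by
  unfold lap
  simp only [Finset.mul_sum, Finset.sum_mul]
  rw [integral_finsetSum, integral_finsetSum]
  · refine Finset.sum_congr rfl fun i _ => ?_
    rw [ibp1 ha (contDiff_dir hb _) (hcs_dir hc _), ibp1 (contDiff_dir ha _) hb hc, neg_neg]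
  · intro i _
    exact ((contDiff_dir (contDiff_dir ha _) _).continuous.mul hb.continuous).integrable_of_hasCompactSupport
      (hc.mul_left)
  · intro i _
    exact (ha.continuous.mul (contDiff_dir (contDiff_dir hb _) _).continuous).integrable_of_hasCompactSupport
      ((hcs_dir (hcs_dir hc _) _).mul_left)

theorem ibp6 {a b : E → ℝ} (ha : ContDiff ℝ ∞ a) (hb : ContDiff ℝ ∞ b) (hc : HasCompactSupport b) :
    ∫ x, a x * lap (lap (lap b)) x = ∫ x, lap (lap (lap a)) x * b x := by
  rw [ibp2 ha (contDiff_lap (contDiff_lap hb)) (hcs_lap (hcs_lap hc)),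
    ibp2 (contDiff_lap ha) (contDiff_lap hb) (hcs_lap hc),
    ibp2 (contDiff_lap (contDiff_lap ha)) hb hc]

/-- Radial Laplacian in the variable `s = r²`. -/
def Lop (n : ℕ) (g : ℝ → ℝ) (s : ℝ) : ℝ := 4 * s * deriv (deriv g) s + 2 * n * deriv g s

theorem contDiffOn_deriv {g : ℝ → ℝ} {a : ℝ} (hg : ContDiffOn ℝ ∞ g (Ioi a)) :
    ContDiffOn ℝ ∞ (deriv g) (Ioi a) :=
  hg.deriv_of_isOpen isOpen_Ioi (by simp)

theorem contDiffOn_Lop {g : ℝ → ℝ} {a : ℝ} (hg : ContDiffOn ℝ ∞ g (Ioi a)) :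
    ContDiffOn ℝ ∞ (Lop n g) (Ioi a) := by
  have h1 := contDiffOn_deriv hg
  have h2 := contDiffOn_deriv h1
  unfold Lop
  exact ((contDiffOn_const.mul contDiffOn_id).mul h2).add (contDiffOn_const.mul h1)

theorem hasDerivAt_of_cdo {g : ℝ → ℝ} {a : ℝ} (hg : ContDiffOn ℝ ∞ g (Ioi a)) {s : ℝ} (hs : a < s) :
    HasDerivAt g (deriv g s) s :=
  ((hg.contDiffAt (isOpen_Ioi.mem_nhds hs)).differentiableAt (by simp)).hasDerivAt

theorem hasFDerivAt_sq (x y : E) :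
    HasFDerivAt (fun y : E => ‖y - x‖ ^ 2) (2 • (innerSL ℝ (y - x))) y := by
  have := ((hasFDerivAt_id (𝕜 := ℝ) y).sub_const x).norm_sq
  simpa using this

theorem fderiv_radial {g : ℝ → ℝ} {a : ℝ} (ha : a < 0) (hg : ContDiffOn ℝ ∞ g (Ioi a)) (x y : E) :
    HasFDerivAt (fun y : E => g (‖y - x‖ ^ 2)) (deriv g (‖y - x‖ ^ 2) • (2 • (innerSL ℝ (y - x)))) y := by
  have hs : a < ‖y - x‖ ^ 2 := lt_of_lt_of_le ha (by positivity)
  exact (hasDerivAt_of_cdo hg hs).comp_hasFDerivAt (f := fun y : E => ‖y - x‖ ^ 2) y (hasFDerivAt_sq x y)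

theorem lap_radial {g : ℝ → ℝ} {a : ℝ} (ha : a < 0) (hg : ContDiffOn ℝ ∞ g (Ioi a)) (x : E) :
    lap (fun y : E => g (‖y - x‖ ^ 2)) = fun y => Lop n g (‖y - x‖ ^ 2) := by
  funext y
  have h1 : ∀ (i : Fin n) , (fun y : E => fderiv ℝ (fun y : E => g (‖y - x‖ ^ 2)) y (EuclideanSpace.single i 1))
      = fun y : E => deriv g (‖y - x‖ ^ 2) * (2 * (y i - x i)) := by
    intro i
    funext y
    rw [(fderiv_radial ha hg x y).fderiv]
    simp [two_mul, EuclideanSpace.inner_single_right]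
  have h2 : ∀ i : Fin n, fderiv ℝ (fun y => fderiv ℝ (fun y : E => g (‖y - x‖ ^ 2)) y (EuclideanSpace.single i 1)) y
    (EuclideanSpace.single i 1) = 4 * deriv (deriv g) (‖y - x‖ ^ 2) * (y i - x i)^2 + 2 * deriv g (‖y - x‖ ^ 2) := by
    intro i
    rw [h1 i]
    have h3 : HasFDerivAt (fun y : E => y i - x i) (EuclideanSpace.proj i : E →L[ℝ] ℝ) y := by
      have := (EuclideanSpace.proj (𝕜 := ℝ) i : E →L[ℝ] ℝ).hasFDerivAt (x := y)
      simpa using this.sub_const (x i)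
    have h4 := (fderiv_radial ha (contDiffOn_deriv hg) x y).mul (h3.const_mul 2)
    rw [HasFDerivAt.fderiv (f := fun y : E => deriv g (‖y - x‖ ^ 2) * (2 * (y i - x i))) h4]
    simp [EuclideanSpace.inner_single_right]
    ring
  unfold lap
  simp only [h2]
  rw [Finset.sum_add_distrib, ← Finset.mul_sum]
  have h5 : ‖y - x‖ ^ 2 = ∑ i, (y i - x i)^2 := by
    rw [EuclideanSpace.norm_sq_eq]; simp
  rw [← h5]
  unfold Lop
  simp
  ring

theorem lap3_radial {g : ℝ → ℝ} {a : ℝ} (ha : a < 0) (hg : ContDiffOn ℝ ∞ g (Ioi a)) (x : E) :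
    lap (lap (lap (fun y : E => g (‖y - x‖ ^ 2)))) = fun y => Lop n (Lop n (Lop n g)) (‖y - x‖ ^ 2) := by
  rw [lap_radial ha hg, lap_radial ha (contDiffOn_Lop hg), lap_radial ha (contDiffOn_Lop (contDiffOn_Lop hg))]

theorem Lop_of {g g1 g2 : ℝ → ℝ} {a : ℝ} (h1 : ∀ s > a, HasDerivAt g (g1 s) s)
    (h2 : ∀ s > a, HasDerivAt g1 (g2 s) s) : ∀ s > a, Lop n g s = 4 * s * g2 s + 2 * n * g1 s := by
  intro s hs
  unfold Lop
  have : deriv g =ᶠ[𝓝 s] g1 := by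
    filter_upwards [isOpen_Ioi.mem_nhds hs] with t ht
    exact (h1 t ht).deriv
  rw [this.deriv_eq, (h1 s hs).deriv, (h2 s hs).deriv]

theorem Lop_congr {g h : ℝ → ℝ} {a : ℝ} (hh : ∀ s > a, g s = h s) : ∀ s > a, Lop n g s = Lop n h s := by
  intro s hs
  have : g =ᶠ[𝓝 s] h := by
    filter_upwards [isOpen_Ioi.mem_nhds hs] with t ht
    exact hh t ht
  unfold Lop
  rw [this.deriv_eq, this.deriv.deriv_eq]

/-- third power of the radial Laplacian -/
theorem Lop3 {g g1 g2 g3 g4 g5 g6 : ℝ → ℝ} {a : ℝ}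
    (h1 : ∀ s > a, HasDerivAt g (g1 s) s)
    (h2 : ∀ s > a, HasDerivAt g1 (g2 s) s)
    (h3 : ∀ s > a, HasDerivAt g2 (g3 s) s)
    (h4 : ∀ s > a, HasDerivAt g3 (g4 s) s)
    (h5 : ∀ s > a, HasDerivAt g4 (g5 s) s)
    (h6 : ∀ s > a, HasDerivAt g5 (g6 s) s) :
    ∀ s > a, Lop n (Lop n (Lop n g)) s = 64 * s^3 * g6 s + 96 * (n + 4) * s^2 * g5 s
      + 48 * (n+2) * (n+4) * s * g4 s + 8 * n * (n + 2) * (n+4) * g3 s := by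
  have e1 := Lop_of (n := n) h1 h2
  have e2 : ∀ s > a, Lop n (fun s => 4 * s * g2 s + 2 * n * g1 s) s =
      16 * s^2 * g4 s + 16 * (n + 2) * s * g3 s + 4 * n * (n+2) * g2 s := by
    intro s hs
    rw [Lop_of (n := n) (g1 := fun s => 4 * s * g3 s + (4 + 2 * n) * g2 s)
      (g2 := fun s => 4 * s * g4 s + (8 + 2 * n) * g3 s) _ _ s hs]
    · ring
    · intro s hs
      have := (((hasDerivAt_id s).const_mul 4).mul (h3 s hs)).add ((h2 s hs).const_mul (2 * (n:ℝ)))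
      refine this.congr_deriv ?_
      simp; ring
    · intro s hs
      have := (((hasDerivAt_id s).const_mul 4).mul (h4 s hs)).add ((h3 s hs).const_mul (4 + 2 * (n:ℝ)))
      refine this.congr_deriv ?_
      simp; ring
  have e3 := Lop_congr (n := n) e1
  intro s hs
  rw [Lop_congr (n := n) (fun t ht => (e3 t ht).trans (e2 t ht)) s hs]
  rw [Lop_of (n := n) (g1 := fun s => 16 * s^2 * g5 s + (16 * (n+2) + 32) * s * g4 s + (16 * (n+2) + 4 * n * (n+2)) * g3 s)
      (g2 := fun s => 16 * s^2 * g6 s + (16 * (n+2) + 64) * s * g5 s +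
        (32 * (n+2) + 32 + 4 * n * (n+2)) * g4 s) _ _ s hs]
  · ring
  · intro s hs
    have := ((((hasDerivAt_id s).pow 2).const_mul 16).mul (h5 s hs)).add
      ((((hasDerivAt_id s).const_mul (16 * ((n:ℝ)+2))).mul (h4 s hs)))
    have := this.add ((h3 s hs).const_mul (4 * (n:ℝ) * (n+2)))
    refine this.congr_deriv ?_
    simp; ring
  · intro s hs
    have := ((((hasDerivAt_id s).pow 2).const_mul 16).mul (h6 s hs)).add
      ((((hasDerivAt_id s).const_mul (16 * ((n:ℝ)+2) + 32)).mul (h5 s hs)))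
    have := this.add ((h4 s hs).const_mul (16 * ((n:ℝ)+2) + 4 * (n:ℝ) * (n+2)))
    refine this.congr_deriv ?_
    simp; ring

end calculus
end Bubble

open MeasureTheory Set Filter Topology
open scoped ContDiff
namespace Bubble

section radial
variable {n : ℕ}

local notation "E" => EuclideanSpace ℝ (Fin n)

theorem Lop_const_mul (c : ℝ) (g : ℝ → ℝ) : Lop n (fun s => c * g s) = fun s => c * Lop n g s := by
  funext s
  unfold Lop
  have : deriv (fun s => c * g s) = fun s => c * deriv g s := by
    funext t; exact deriv_const_mul_field c
  rw [this, deriv_const_mul_field]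
  ring

theorem Lop_scale (c : ℝ) (g : ℝ → ℝ) : Lop n (fun s => g (c * s)) = fun s => c * Lop n g (c * s) := by
  funext s
  unfold Lop
  have : deriv (fun s => g (c * s)) = fun s => c * deriv g (c * s) := by
    funext t; rw [deriv_comp_mul_left]; rfl
  rw [this, deriv_const_mul_field, deriv_comp_mul_left]
  simp only [smul_eq_mul]
  ring

theorem Lop3_scale (a c : ℝ) (g : ℝ → ℝ) (s : ℝ) :
    Lop n (Lop n (Lop n (fun s => a * g (c * s)))) s = a * (c ^ 3 * Lop n (Lop n (Lop n g)) (c * s)) := by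
  rw [Lop_const_mul, Lop_const_mul, Lop_const_mul, Lop_scale, Lop_const_mul, Lop_const_mul,
    Lop_scale, Lop_const_mul, Lop_scale]
  ring

theorem Lop3_congr {g h : ℝ → ℝ} {s : ℝ} (hh : g =ᶠ[𝓝 s] h) :
    Lop n (Lop n (Lop n g)) s = Lop n (Lop n (Lop n h)) s := by
  have key : ∀ {g h : ℝ → ℝ}, g =ᶠ[𝓝 s] h → Lop n g =ᶠ[𝓝 s] Lop n h := by
    intro g h hh
    filter_upwards [hh.eventuallyEq_nhds] with t ht
    unfold Lop
    rw [ht.deriv_eq, ht.deriv.deriv_eq]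
  exact (key (key (key hh))).eq_of_nhds

theorem Lop3_zero (s : ℝ) : Lop n (Lop n (Lop n (fun _ => 0))) s = 0 := by
  have : Lop n (fun _ => (0:ℝ)) = fun _ => 0 := by
    funext t; simp [Lop]
  rw [this, this, this]

theorem contDiffOn_bub {ε q : ℝ} : ContDiffOn ℝ ∞ (fun s : ℝ => (ε + s) ^ q) (Ioi (-ε)) := by
  intro s hs
  have : ε + s ≠ 0 := by have : -ε < s := hs; linarith
  exact ((contDiffAt_const.add contDiffAt_id).rpow_const_of_ne this).contDiffWithinAt

theorem hasDerivAt_bub {ε q c : ℝ} (s : ℝ) (hs : s > -ε) :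
    HasDerivAt (fun s : ℝ => c * (ε + s) ^ q) (c * q * (ε + s) ^ (q - 1)) s := by
  have h0 : ε + s ≠ 0 := by linarith
  have h := ((hasDerivAt_id s).const_add ε).rpow_const (p := q) (Or.inl h0)
  refine (h.const_mul c).congr_deriv ?_
  simp; ring

theorem Lop3_bub {ε : ℝ} (s : ℝ) (hs : s > -ε) :
    Lop n (Lop n (Lop n (fun s : ℝ => (ε + s) ^ (-(((n:ℝ) - 6)/2))))) s
      = - (64 * cst n * ε ^ 3 * (ε + s) ^ (-(((n:ℝ) + 6)/2))) := by
  set q : ℝ := -(((n:ℝ) - 6)/2) with hq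
  have e : (fun s : ℝ => (ε + s) ^ q) = fun s => 1 * (ε + s) ^ q := by funext; simp
  rw [e]
  rw [Lop3 (n := n) (a := -ε) (fun s hs => hasDerivAt_bub s hs) (fun s hs => hasDerivAt_bub s hs)
    (fun s hs => hasDerivAt_bub s hs) (fun s hs => hasDerivAt_bub s hs)
    (fun s hs => hasDerivAt_bub s hs) (fun s hs => hasDerivAt_bub s hs) s hs]
  have h0 : 0 < ε + s := by linarith
  have hn : (n:ℝ) = 6 - 2 * q := by rw [hq]; ring
  have h6 : -(((n:ℝ) + 6)/2) = q - 1 - 1 - 1 - 1 - 1 - 1 := by rw [hq]; ring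
  rw [h6]
  have r5 : (ε + s) ^ (q - 1 - 1 - 1 - 1 - 1) = (ε + s) ^ (q - 1 - 1 - 1 - 1 - 1 - 1) * (ε + s) := by
    rw [Real.rpow_sub_one h0.ne' (q - 1 - 1 - 1 - 1 - 1)]; field_simp
  have r4 : (ε + s) ^ (q - 1 - 1 - 1 - 1) = (ε + s) ^ (q - 1 - 1 - 1 - 1 - 1) * (ε + s) := by
    rw [Real.rpow_sub_one h0.ne' (q - 1 - 1 - 1 - 1)]; field_simp
  have r3 : (ε + s) ^ (q - 1 - 1 - 1) = (ε + s) ^ (q - 1 - 1 - 1 - 1) * (ε + s) := by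
    rw [Real.rpow_sub_one h0.ne' (q - 1 - 1 - 1)]; field_simp
  rw [r3, r4, r5]
  generalize (ε + s) ^ (q - 1 - 1 - 1 - 1 - 1 - 1) = T
  unfold cst
  rw [hn]
  ring

/-- Families of functions jointly smooth in a parameter. -/
def Om : Set (ℝ × ℝ) := {z | 0 < z.1 + z.2}

theorem isOpen_Om : IsOpen Om := isOpen_lt continuous_const (by fun_prop)

theorem joint_deriv {F : ℝ → ℝ → ℝ} (hF : ContDiffOn ℝ ∞ (fun z : ℝ × ℝ => F z.1 z.2) Om) :
    ContDiffOn ℝ ∞ (fun z : ℝ × ℝ => deriv (F z.1) z.2) Om := by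
  have h1 : ContDiffOn ℝ ∞ (fun z : ℝ × ℝ => fderiv ℝ (fun z : ℝ × ℝ => F z.1 z.2) z (0,1)) Om :=
    (hF.fderiv_of_isOpen isOpen_Om (m := ∞) (by simp)).clm_apply contDiffOn_const
  refine h1.congr ?_
  rintro ⟨e, s⟩ hz
  have hd := ((hF.contDiffAt (isOpen_Om.mem_nhds hz)).differentiableAt (by simp)).hasFDerivAt
  have hp : HasDerivAt (fun t : ℝ => ((e, t) : ℝ × ℝ)) ((0:ℝ), (1:ℝ)) s :=
    (hasDerivAt_const s e).prodMk (hasDerivAt_id s)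
  exact (HasFDerivAt.comp_hasDerivAt (f := fun t : ℝ => ((e, t) : ℝ × ℝ)) s hd hp).deriv

theorem joint_Lop {F : ℝ → ℝ → ℝ} (hF : ContDiffOn ℝ ∞ (fun z : ℝ × ℝ => F z.1 z.2) Om) :
    ContDiffOn ℝ ∞ (fun z : ℝ × ℝ => Lop n (F z.1) z.2) Om := by
  have h1 := joint_deriv hF
  have h2 := joint_deriv (F := fun e => deriv (F e)) h1
  unfold Lop
  exact ((contDiffOn_const.mul contDiffOn_snd).mul h2).add (contDiffOn_const.mul h1)

/-- the cutoff -/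
def phi (s : ℝ) : ℝ := Real.smoothTransition (2 - 4 * s)

theorem phi_contDiff : ContDiff ℝ ∞ phi :=
  Real.smoothTransition.contDiff.comp (by fun_prop)
theorem phi_nonneg (s : ℝ) : 0 ≤ phi s := Real.smoothTransition.nonneg _
theorem phi_le_one (s : ℝ) : phi s ≤ 1 := Real.smoothTransition.le_one _
theorem phi_one {s : ℝ} (h : s ≤ 1/4) : phi s = 1 := Real.smoothTransition.one_of_one_le (by linarith)
theorem phi_zero {s : ℝ} (h : 1/2 ≤ s) : phi s = 0 := Real.smoothTransition.zero_of_nonpos (by linarith)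

def gam (q e s : ℝ) : ℝ := phi s * (e + s) ^ q

theorem gam_joint (q : ℝ) : ContDiffOn ℝ ∞ (fun z : ℝ × ℝ => gam q z.1 z.2) Om := by
  unfold gam
  apply ContDiffOn.mul
  · exact (phi_contDiff.comp contDiff_snd).contDiffOn
  · intro z hz
    have : z.1 + z.2 ≠ 0 := ne_of_gt hz
    exact ((contDiffAt_fst.add contDiffAt_snd).rpow_const_of_ne this).contDiffWithinAt

theorem gam_bound (n : ℕ) (q : ℝ) : ∃ C : ℝ, 0 ≤ C ∧ ∀ e ∈ Ioc (0:ℝ) 1, ∀ s : ℝ, 1/4 ≤ s →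
    |Lop n (Lop n (Lop n (gam q e))) s| ≤ C := by
  have h := (joint_Lop (n := n) (F := fun e => Lop n (Lop n (gam q e)))
    (joint_Lop (n := n) (F := fun e => Lop n (gam q e)) (joint_Lop (n := n) (gam_joint q)))).continuousOn
  have hK : IsCompact (Icc (0:ℝ) 1 ×ˢ Icc (1/4:ℝ) 1) := isCompact_Icc.prod isCompact_Icc
  have hsub : Icc (0:ℝ) 1 ×ˢ Icc (1/4:ℝ) 1 ⊆ Om := by
    rintro ⟨a, b⟩ ⟨h1, h2⟩
    simp only [Om, mem_setOf_eq, mem_Icc] at *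
    linarith
  obtain ⟨C, hC⟩ := hK.exists_bound_of_continuousOn (h.mono hsub)
  refine ⟨max C 0, le_max_right _ _, fun e he s hs => ?_⟩
  by_cases h1 : s ≤ 1
  · exact (hC (e, s) ⟨⟨he.1.le, he.2⟩, ⟨hs, h1⟩⟩).trans (le_max_left _ _)
  · have : gam q e =ᶠ[𝓝 s] fun _ => 0 := by
      filter_upwards [isOpen_Ioi.mem_nhds (show (1:ℝ) < s by linarith)] with t ht
      have : (1:ℝ) < t := ht
      rw [gam, phi_zero (by linarith), zero_mul]
    rw [Lop3_congr this, Lop3_zero, abs_zero]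
    exact le_max_right _ _

theorem pow_step {k : ℕ} {h : ℝ → ℝ} (hh : ContDiff ℝ ∞ h) : ∃ h' : ℝ → ℝ, ContDiff ℝ ∞ h' ∧
    ∀ s, HasDerivAt (fun s => phi s ^ (k+1) * h s) (phi s ^ k * h' s) s := by
  refine ⟨fun s => (k+1) * deriv phi s * h s + phi s * deriv h s, ?_, fun s => ?_⟩
  · have h1 : ContDiff ℝ ∞ (deriv phi) := ((contDiff_infty_iff_deriv).1 phi_contDiff).2
    have h2 : ContDiff ℝ ∞ (deriv h) := ((contDiff_infty_iff_deriv).1 hh).2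
    exact ((contDiff_const.mul h1).mul hh).add (phi_contDiff.mul h2)
  · have d1 := ((phi_contDiff.differentiable (by simp)) s).hasDerivAt
    have d2 := ((hh.differentiable (by simp)) s).hasDerivAt
    refine ((d1.pow (k+1)).mul d2).congr_deriv ?_
    push_cast
    simp
    ring

theorem phi_pow_bound (n k : ℕ) (hk : 0 < k) : ∃ C : ℝ, 0 ≤ C ∧ ∀ s : ℝ, 0 ≤ s →
    |Lop n (Lop n (Lop n (fun s => phi s ^ (k+6)))) s| ≤ C * phi s ^ k := by
  obtain ⟨h1, c1, d1⟩ := pow_step (k := k+5) (contDiff_const (c := (1:ℝ)))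
  obtain ⟨h2, c2, d2⟩ := pow_step (k := k+4) c1
  obtain ⟨h3, c3, d3⟩ := pow_step (k := k+3) c2
  obtain ⟨h4, c4, d4⟩ := pow_step (k := k+2) c3
  obtain ⟨h5, c5, d5⟩ := pow_step (k := k+1) c4
  obtain ⟨h6, c6, d6⟩ := pow_step (k := k) c5
  have e : (fun s => phi s ^ (k+6)) = fun s => phi s ^ (k+5+1) * 1 := by funext s; simp
  have key := Lop3 (n := n) (a := -1) (fun s _ => d1 s) (fun s _ => d2 s) (fun s _ => d3 s)
    (fun s _ => d4 s) (fun s _ => d5 s) (fun s _ => d6 s)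
  rw [e]
  set H : ℝ → ℝ := fun s => 64 * s^3 * h6 s + 96 * (n + 4) * s^2 * (phi s * h5 s)
      + 48 * (n+2) * (n+4) * s * (phi s ^ 2 * h4 s) + 8 * n * (n + 2) * (n+4) * (phi s ^3 * h3 s) with hH
  have hc : Continuous H := by
    have := phi_contDiff.continuous
    have := c6.continuous
    have := c5.continuous
    have := c4.continuous
    have := c3.continuous
    fun_prop
  obtain ⟨C, hC⟩ := (isCompact_Icc (a := (0:ℝ)) (b := 1)).exists_bound_of_continuousOn hc.continuousOn
  have hC0 : 0 ≤ C := (norm_nonneg _).trans (hC 0 ⟨le_rfl, zero_le_one⟩)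
  refine ⟨C, hC0, fun s hs => ?_⟩
  rw [key s (by linarith)]
  have : 64 * s ^ 3 * (phi s ^ k * h6 s) + 96 * (↑n + 4) * s ^ 2 * (phi s ^ (k + 1) * h5 s) +
        48 * (↑n + 2) * (↑n + 4) * s * (phi s ^ (k + 2) * h4 s) +
      8 * ↑n * (↑n + 2) * (↑n + 4) * (phi s ^ (k + 3) * h3 s) = H s * phi s ^ k := by
    rw [hH]; ring
  rw [this, abs_mul, abs_of_nonneg (pow_nonneg (phi_nonneg s) k)]
  by_cases h1 : s ≤ 1
  · exact mul_le_mul_of_nonneg_right (hC s ⟨hs, h1⟩) (pow_nonneg (phi_nonneg s) k)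
  · rw [phi_zero (by linarith), zero_pow hk.ne']; simp

end radial
end Bubble

open MeasureTheory Set Filter Topology
open scoped ContDiff
namespace Bubble

section estimates
variable {n : ℕ}

local notation "E" => EuclideanSpace ℝ (Fin n)

theorem contDiff_radial {g : ℝ → ℝ} {a : ℝ} (ha : a < 0) (hg : ContDiffOn ℝ ∞ g (Ioi a)) (x : E) :
    ContDiff ℝ ∞ (fun y : E => g (‖y - x‖ ^ 2)) := by
  refine hg.comp_contDiff (f := fun y : E => ‖y - x‖ ^ 2) ?_ ?_
  · exact (contDiff_id.sub contDiff_const).norm_sq ℝ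
  · intro y; exact lt_of_lt_of_le ha (by positivity)

theorem hcs_radial {g : ℝ → ℝ} {R : ℝ} (hR : 0 ≤ R) (hg : ∀ s, R^2 ≤ s → g s = 0) (x : E) :
    HasCompactSupport (fun y : E => g (‖y - x‖ ^ 2)) := by
  refine HasCompactSupport.intro (isCompact_closedBall x R) fun y hy => ?_
  apply hg
  have : R < ‖y - x‖ := by simpa [dist_eq_norm] using hy
  gcongr

/-- The exponent `p`. -/
def pe (n : ℕ) : ℝ := ((n:ℝ)+6)/((n:ℝ)-6)

theorem pe_gt (hn : 7 ≤ n) : 1 < pe n := by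
  have : (7:ℝ) ≤ n := by exact_mod_cast hn
  unfold pe
  rw [lt_div_iff₀ (by linarith)]; linarith

theorem cst_pos (hn : 7 ≤ n) : 0 < cst n := by
  have : (7:ℝ) ≤ n := by exact_mod_cast hn
  unfold cst
  have h1 : 0 < (n:ℝ) - 6 := by linarith
  have h2 : 0 < (n:ℝ) - 4 := by linarith
  have h3 : 0 < (n:ℝ) - 2 := by linarith
  positivity

/-- The hypotheses of the theorem. -/
structure IsSol (u : E → ℝ) : Prop where
  smooth : ContDiff ℝ ∞ u
  pos : ∀ x, 0 < u x
  eqn : ∀ x, -(lap (lap (lap u)) x) = cst n * u x ^ pe n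

theorem IsSol.cont_pow {u : E → ℝ} (h : IsSol u) : Continuous (fun y => u y ^ pe n) :=
  h.smooth.continuous.rpow_const fun x => Or.inl (h.pos x).ne'

theorem IsSol.test {u : E → ℝ} (h : IsSol u) {g : ℝ → ℝ} {a R : ℝ} (ha : a < 0)
    (hg : ContDiffOn ℝ ∞ g (Ioi a)) (hR : 0 ≤ R) (hgR : ∀ s, R^2 ≤ s → g s = 0) (x : E) :
    cst n * ∫ y, u y ^ pe n * g (‖y - x‖^2) =
      ∫ y, u y * (- Lop n (Lop n (Lop n g)) (‖y - x‖ ^ 2)) := by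
  have h1 := ibp6 h.smooth (contDiff_radial ha hg x) (hcs_radial hR hgR x)
  rw [lap3_radial ha hg] at h1
  rw [← integral_const_mul]
  simp only [mul_neg]
  rw [integral_neg, h1, ← integral_neg]
  congr 1
  funext y
  have := h.eqn y
  rw [← mul_assoc, ← this]; ring

theorem IsSol.test_int {u : E → ℝ} (h : IsSol u) {g : ℝ → ℝ} {a R : ℝ} (ha : a < 0)
    (hg : ContDiffOn ℝ ∞ g (Ioi a)) (hR : 0 ≤ R) (hgR : ∀ s, R^2 ≤ s → g s = 0) (x : E) :
    Integrable (fun y => u y * (- Lop n (Lop n (Lop n g)) (‖y - x‖ ^ 2))) := by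
  have h1 := contDiff_lap (contDiff_lap (contDiff_lap (contDiff_radial ha hg x)))
  have h2 := hcs_lap (hcs_lap (hcs_lap (hcs_radial hR hgR x)))
  rw [lap3_radial ha hg] at h1 h2
  have := (h.smooth.continuous.mul h1.continuous).integrable_of_hasCompactSupport (μ := volume) (h2.mul_left)
  refine this.neg.congr (Eventually.of_forall fun y => ?_)
  simp

theorem IsSol.test_int' {u : E → ℝ} (h : IsSol u) {g : ℝ → ℝ} {a R : ℝ} (ha : a < 0)
    (hg : ContDiffOn ℝ ∞ g (Ioi a)) (hR : 0 ≤ R) (hgR : ∀ s, R^2 ≤ s → g s = 0) (x : E) :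
    Integrable (fun y => u y ^ pe n * g (‖y - x‖ ^ 2)) :=
  (h.cont_pow.mul (contDiff_radial ha hg x).continuous).integrable_of_hasCompactSupport
    (hcs_radial hR hgR x).mul_left

theorem vol_ball (x : E) {R : ℝ} (hR : 0 ≤ R) :
    volume.real (Metric.closedBall x R) = R ^ n * volume.real (Metric.ball (0:E) 1) := by
  rw [Measure.addHaar_real_closedBall _ _ hR]
  simp

theorem IsSol.E1 (hn : 7 ≤ n) {u : E → ℝ} (h : IsSol u) : ∃ C R0 : ℝ, 0 ≤ C ∧ 0 < R0 ∧
    ∀ (x : E) (R : ℝ), R0 ≤ R →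
      Integrable (fun y => u y ^ pe n * phi ((R^2)⁻¹ * ‖y - x‖^2) ^ (n + 6)) ∧
      ∫ y, u y ^ pe n * phi ((R^2)⁻¹ * ‖y - x‖^2) ^ (n + 6) ≤ C * (R ^ n / R ^ 6) := by
  obtain ⟨C, hC0, hC⟩ := phi_pow_bound n n (by omega)
  have hc := cst_pos hn
  have hp := pe_gt hn
  set om := volume.real (Metric.ball (0:E) 1)
  have hom : 0 ≤ om := measureReal_nonneg
  refine ⟨2 * C / cst n * om, max 1 (2 * C / cst n), by positivity, by positivity, fun x R hR => ?_⟩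
  have hR1 : 1 ≤ R := (le_max_left _ _).trans hR
  have hR2 : 2 * C / cst n ≤ R := (le_max_right _ _).trans hR
  have hR0 : 0 < R := by linarith
  set g : ℝ → ℝ := fun s => 1 * (fun s => phi s ^ (n+6)) ((R^2)⁻¹ * s) with hg
  have hgs : ContDiffOn ℝ ∞ g (Ioi (-1)) := by
    have : ContDiff ℝ ∞ g := contDiff_const.mul ((phi_contDiff.comp (contDiff_const.mul contDiff_id)).pow _)
    exact this.contDiffOn
  have hgz : ∀ s, R^2 ≤ s → g s = 0 := by
    intro s hs
    have : 1 ≤ (R^2)⁻¹ * s := by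
      rw [inv_mul_eq_div, le_div_iff₀ (by positivity)]; linarith
    simp only [hg]
    rw [phi_zero (by linarith)]; simp
  have hI := h.test_int' (by norm_num) hgs hR0.le hgz x
  have hI2 := h.test_int (by norm_num) hgs hR0.le hgz x
  have hT := h.test (by norm_num) hgs hR0.le hgz x
  have e : (fun y => u y ^ pe n * phi ((R^2)⁻¹ * ‖y - x‖^2) ^ (n + 6)) = fun y => u y ^ pe n * g (‖y - x‖ ^ 2) := by
    funext y; simp [hg]
  rw [e]
  refine ⟨hI, ?_⟩
  set I := ∫ y, u y ^ pe n * g (‖y - x‖ ^ 2) with hIdef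
  have hind : Integrable ((Metric.closedBall x R).indicator fun _ => (1:ℝ)) :=
    (integrable_indicator_iff measurableSet_closedBall).2
      (integrableOn_const (by exact (measure_closedBall_lt_top).ne))
  have hI0 : 0 ≤ I := by
    apply integral_nonneg
    intro y
    have := (h.pos y).le
    have := phi_nonneg ((R^2)⁻¹ * ‖y - x‖ ^ 2)
    simp only [hg]
    positivity
  have hle : cst n * I ≤ (C / R^6) * (R^n * om + I) := by
    rw [hT, ← vol_ball x hR0.le]
    have : volume.real (Metric.closedBall x R) = ∫ y, (Metric.closedBall x R).indicator (fun _ => (1:ℝ)) y := by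
      rw [integral_indicator measurableSet_closedBall]; simp
    rw [this, hIdef, ← integral_add hind hI, ← integral_const_mul]
    refine integral_mono hI2 ((hind.add hI).const_mul _) fun y => ?_
    have hu := h.pos y
    set s := (R^2)⁻¹ * ‖y - x‖ ^ 2 with hs
    have hs0 : 0 ≤ s := by positivity
    have b1 : - Lop n (Lop n (Lop n g)) (‖y - x‖ ^ 2) ≤ C / R^6 * phi s ^ n := by
      rw [hg, Lop3_scale 1 (R^2)⁻¹ (fun s => phi s ^ (n+6)) (‖y - x‖^2)]
      have := hC s hs0
      have h2 := neg_le_of_abs_le this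
      have : -(1 * (((R ^ 2)⁻¹) ^ 3 * Lop n (Lop n (Lop n fun s => phi s ^ (n + 6))) s)) =
        (1/R^6) * (- Lop n (Lop n (Lop n fun s => phi s ^ (n + 6))) s) := by
        field_simp
      have e2 : C / R^6 * phi s ^ n = 1 / R^6 * (C * phi s ^ n) := by ring
      rw [this, e2]
      gcongr
      linarith
    have hφ := phi_nonneg s
    have hφ1 := phi_le_one s
    have b2 : u y * phi s ^ n ≤ (Metric.closedBall x R).indicator (fun _ => (1:ℝ)) y + u y ^ pe n * g (‖y - x‖ ^ 2) := by
      have hgy : g (‖y - x‖ ^ 2) = phi s ^ (n+6) := by simp [hg, hs]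
      rw [hgy]
      by_cases hin : y ∈ Metric.closedBall x R
      · rw [indicator_of_mem hin]
        have h3 : 0 ≤ u y ^ pe n * phi s ^ (n + 6) := by positivity
        by_cases h1 : u y * phi s ^ n ≤ 1
        · linarith
        · push Not at h1
          have h4 : u y * phi s ^ n ≤ (u y * phi s ^ n) ^ pe n := by
            conv_lhs => rw [← Real.rpow_one (u y * phi s ^ n)]
            exact Real.rpow_le_rpow_of_exponent_le h1.le hp.le
          have h5 : (u y * phi s ^ n) ^ pe n = u y ^ pe n * (phi s ^ n) ^ pe n :=
            Real.mul_rpow hu.le (by positivity)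
          have h6 : (phi s ^ n) ^ pe n ≤ phi s ^ (n+6) := by
            have hφ0 : 0 < phi s := by
              rcases hφ.lt_or_eq with h | h
              · exact h
              · rw [← h, zero_pow (by omega)] at h1; simp at h1; linarith
            rw [← Real.rpow_natCast, ← Real.rpow_natCast, ← Real.rpow_mul hφ]
            apply Real.rpow_le_rpow_of_exponent_ge hφ0 hφ1
            have : (7:ℝ) ≤ n := by exact_mod_cast hn
            unfold pe
            push_cast
            rw [mul_div_assoc', le_div_iff₀ (by linarith)]
            nlinarith
          have : u y ^ pe n * (phi s ^ n) ^ pe n ≤ u y ^ pe n * phi s ^ (n+6) := by gcongr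
          linarith
      · rw [indicator_of_notMem hin]
        have : R < ‖y - x‖ := by simpa [dist_eq_norm] using hin
        have : 1 ≤ s := by
          rw [hs, inv_mul_eq_div, le_div_iff₀ (by positivity), one_mul]
          gcongr
        rw [phi_zero (by linarith), zero_pow (by omega)]
        simp
    calc u y * - Lop n (Lop n (Lop n g)) (‖y - x‖ ^ 2) ≤ u y * (C / R^6 * phi s ^ n) := by gcongr
      _ = C / R^6 * (u y * phi s ^ n) := by ring
      _ ≤ _ := by gcongr
  have hsmall : C / R^6 ≤ cst n / 2 := by
    have : 2 * C / cst n ≤ R ^ 6 := hR2.trans (by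
      calc R = R ^ 1 := (pow_one R).symm
        _ ≤ R ^ 6 := pow_le_pow_right₀ hR1 (by norm_num))
    rw [div_le_iff₀ hc] at this
    rw [div_le_iff₀ (by positivity)]
    linarith
  have h7 : C / R^6 * I ≤ cst n / 2 * I := by gcongr
  have h8 : cst n * I ≤ 2 * C * om * (R^n / R^6) := by
    have : (C / R^6) * (R^n * om + I) = C * om * (R^n/R^6) + C / R^6 * I := by ring
    rw [this] at hle
    nlinarith
  have : 2 * C / cst n * om * (R ^ n / R ^ 6) = (2 * C * om * (R^n / R^6)) / cst n := by ring
  rw [this, le_div_iff₀ hc]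
  linarith

theorem IsSol.avg (hn : 7 ≤ n) {u : E → ℝ} (h : IsSol u) (x : E) :
    Tendsto (fun R : ℝ => (R^n)⁻¹ * ∫ y in Metric.closedBall x R, u y) atTop (𝓝 0) := by
  obtain ⟨C, R0, hC0, hR0, hE⟩ := h.E1 hn
  have hp := pe_gt hn
  set om := volume.real (Metric.ball (0:E) 1)
  have hom : 0 ≤ om := measureReal_nonneg
  have key : ∀ δ > 0, ∀ R ≥ R0, (R^n)⁻¹ * ∫ y in Metric.closedBall x R, u y ≤
      δ * om + (δ^(pe n - 1))⁻¹ * C * 2^n / R^6 := by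
    intro δ hδ R hR
    have hRp : 0 < R := by linarith
    obtain ⟨hi, hb⟩ := hE x (2*R) (by linarith)
    have i1 : IntegrableOn (fun y => u y ^ pe n) (Metric.closedBall x R) :=
      h.cont_pow.continuousOn.integrableOn_compact (isCompact_closedBall x R)
    have i2 : IntegrableOn u (Metric.closedBall x R) :=
      h.smooth.continuous.continuousOn.integrableOn_compact (isCompact_closedBall x R)
    have i3 : IntegrableOn (fun _ : E => δ) (Metric.closedBall x R) :=
      integrableOn_const (by exact (measure_closedBall_lt_top).ne)
    have s1 : ∫ y in Metric.closedBall x R, u y ≤ ∫ y in Metric.closedBall x R, (δ + (δ^(pe n - 1))⁻¹ * u y ^ pe n) := by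
      refine integral_mono i2 (i3.add (i1.const_mul _)) fun y => ?_
      have hu := h.pos y
      show u y ≤ δ + (δ^(pe n - 1))⁻¹ * u y ^ pe n
      have hpos : 0 ≤ (δ^(pe n - 1))⁻¹ * u y ^ pe n := by positivity
      by_cases hlt : u y ≤ δ
      · linarith
      · push Not at hlt
        have e1 : u y ^ pe n = u y ^ (pe n - 1) * u y := by
          rw [← Real.rpow_add_one hu.ne']; ring_nf
        have e2 : δ ^ (pe n - 1) ≤ u y ^ (pe n - 1) := Real.rpow_le_rpow hδ.le hlt.le (by linarith)
        have : u y ≤ (δ^(pe n - 1))⁻¹ * u y ^ pe n := by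
          rw [inv_mul_eq_div, le_div_iff₀ (by positivity), e1, mul_comm]
          gcongr
        linarith
    have s2 : ∫ y in Metric.closedBall x R, (δ + (δ^(pe n - 1))⁻¹ * u y ^ pe n) =
        δ * (R^n * om) + (δ^(pe n - 1))⁻¹ * ∫ y in Metric.closedBall x R, u y ^ pe n := by
      rw [integral_add i3 (i1.const_mul _), integral_const_mul, ← vol_ball x hRp.le]
      simp [mul_comm]
    have s3 : ∫ y in Metric.closedBall x R, u y ^ pe n ≤ C * ((2*R)^n / (2*R)^6) := by
      refine le_trans ?_ hb
      have : ∫ y in Metric.closedBall x R, u y ^ pe n = ∫ y in Metric.closedBall x R, u y ^ pe n * phi (((2*R)^2)⁻¹ * ‖y - x‖^2) ^ (n + 6) := by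
        refine setIntegral_congr_fun measurableSet_closedBall fun y hy => ?_
        have hy' : ‖y - x‖ ≤ R := by simpa [dist_eq_norm] using hy
        have : ((2*R)^2)⁻¹ * ‖y - x‖^2 ≤ 1/4 := by
          rw [inv_mul_eq_div, div_le_iff₀ (by positivity)]
          have : ‖y - x‖^2 ≤ R^2 := by gcongr
          linarith
        rw [phi_one this]; simp
      rw [this]
      refine setIntegral_le_integral hi (Eventually.of_forall fun y => ?_)
      have := (h.pos y).le
      have := phi_nonneg (((2*R)^2)⁻¹ * ‖y - x‖ ^ 2)
      show 0 ≤ u y ^ pe n * phi (((2*R)^2)⁻¹ * ‖y - x‖^2) ^ (n + 6)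
      positivity
    have s4 : ∫ y in Metric.closedBall x R, u y ≤ δ * (R^n * om) + (δ^(pe n - 1))⁻¹ * (C * ((2*R)^n / (2*R)^6)) := by
      rw [s2] at s1
      refine s1.trans ?_
      gcongr
    rw [inv_mul_eq_div, div_le_iff₀ (by positivity)]
    refine s4.trans ?_
    have e3 : (2*R)^n / (2*R)^6 = 2^n * (R^n / R^6) / 64 := by
      rw [mul_pow, mul_pow]; field_simp; norm_num
    rw [e3]
    have : (δ * om + (δ ^ (pe n - 1))⁻¹ * C * 2 ^ n / R ^ 6) * R ^ n = δ * (R^n * om) +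
      (δ ^ (pe n - 1))⁻¹ * (C * (2^n * (R^n / R^6))) := by ring
    rw [this]
    gcongr
    have : 0 ≤ 2^n * (R^n / R^6) := by positivity
    linarith
  rw [Metric.tendsto_atTop]
  intro η hη
  set δ := η / (2 * (om + 1)) with hδ
  have hδ0 : 0 < δ := by positivity
  have hδom : δ * om < η / 2 := by
    have : δ * (om + 1) = η / 2 := by rw [hδ]; field_simp
    linarith
  set D := (δ ^ (pe n - 1))⁻¹ * C * 2 ^ n with hD
  have hD0 : 0 ≤ D := by positivity
  refine ⟨max (max R0 1) (2 * D / η), fun R hR => ?_⟩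
  have a1 : R0 ≤ R := (le_max_left _ _).trans ((le_max_left _ _).trans hR)
  have a2 : 1 ≤ R := (le_max_right _ _).trans ((le_max_left _ _).trans hR)
  have a3 : 2 * D / η ≤ R := (le_max_right _ _).trans hR
  have hk := key δ hδ0 R a1
  have hnn : 0 ≤ (R^n)⁻¹ * ∫ y in Metric.closedBall x R, u y := by
    have : 0 ≤ ∫ y in Metric.closedBall x R, u y := integral_nonneg fun y => (h.pos y).le
    positivity
  rw [Real.dist_eq, sub_zero, abs_of_nonneg hnn]
  have : D / R^6 ≤ η / 2 := by
    rw [div_le_iff₀ (by positivity)]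
    rw [div_le_iff₀ hη] at a3
    have : R ≤ R^6 := by
      calc R = R ^ 1 := (pow_one R).symm
        _ ≤ R ^ 6 := pow_le_pow_right₀ a2 (by norm_num)
    nlinarith
  linarith

end estimates
end Bubble

open MeasureTheory Set Filter Topology
open scoped ContDiff
namespace Bubble

section repr
variable {n : ℕ}

local notation "E" => EuclideanSpace ℝ (Fin n)

theorem nR (hn : 7 ≤ n) : (7:ℝ) ≤ n := by exact_mod_cast hn

theorem kernel_locInt (hn : 7 ≤ n) : LocallyIntegrable (fun z : E => ‖z‖ ^ (-((n:ℝ) - 6))) := by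
  refine locallyIntegrable_of_norm_le_rpow (C := 1) (α := (n:ℝ) - 6) ?_ ?_ (Eventually.of_forall fun z => ?_) ?_
  · simp; omega
  · simp
  · rw [Real.norm_of_nonneg (by positivity)]; simp
  · exact (by fun_prop : Measurable fun z : E => ‖z‖ ^ (-((n:ℝ) - 6))).aestronglyMeasurable

theorem rpow_sq {r : ℝ} (hr : 0 ≤ r) (q : ℝ) : (r^2) ^ q = r ^ (2 * q) := by
  rw [← Real.rpow_natCast, ← Real.rpow_mul hr]; norm_num

/-- test function profile -/
def gt (q t R s : ℝ) : ℝ := (R^2) ^ q * gam q (t^2 / R^2) ((R^2)⁻¹ * s)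

theorem gt_eq {q t R s : ℝ} (hR : 0 < R) (hs : -t^2 < s) :
    gt q t R s = phi ((R^2)⁻¹ * s) * (t^2 + s) ^ q := by
  unfold gt gam
  have h1 : t^2 / R^2 + (R^2)⁻¹ * s = (R^2)⁻¹ * (t^2 + s) := by ring
  rw [h1, Real.mul_rpow (by positivity) (by linarith), Real.inv_rpow (by positivity)]
  have : (R^2) ^ q ≠ 0 := by positivity
  field_simp

theorem gt_smooth {q t R : ℝ} (hR : 0 < R) : ContDiffOn ℝ ∞ (gt q t R) (Ioi (-t^2)) := by
  have : ContDiffOn ℝ ∞ (fun s => phi ((R^2)⁻¹ * s) * (t^2 + s) ^ q) (Ioi (-t^2)) := by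
    apply ContDiffOn.mul
    · exact (phi_contDiff.comp (contDiff_const.mul contDiff_id)).contDiffOn
    · exact contDiffOn_bub
  exact this.congr fun s hs => gt_eq hR hs

theorem gt_zero {q t R : ℝ} (hR : 0 < R) : ∀ s, R^2 ≤ s → gt q t R s = 0 := by
  intro s hs
  have : 1 ≤ (R^2)⁻¹ * s := by
    rw [inv_mul_eq_div, le_div_iff₀ (by positivity)]; linarith
  unfold gt gam
  rw [phi_zero (by linarith)]; simp

theorem gt_far {q t R s : ℝ} (hR : 0 < R) (hs : R^2 < s) : Lop n (Lop n (Lop n (gt q t R))) s = 0 := by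
  have : gt q t R =ᶠ[𝓝 s] fun _ => 0 := by
    filter_upwards [isOpen_Ioi.mem_nhds hs] with t ht
    exact gt_zero hR _ (le_of_lt ht)
  rw [Lop3_congr this, Lop3_zero]

theorem gt_near {t R s : ℝ} (hR : 0 < R) (ht : 0 < t) (hs0 : 0 ≤ s) (hs : s < R^2 / 4) :
    - Lop n (Lop n (Lop n (gt (-(((n:ℝ) - 6)/2)) t R))) s =
      64 * cst n * (t ^ 6 * (t^2 + s) ^ (-(((n:ℝ) + 6)/2))) := by
  have hts : -t^2 < s := by nlinarith
  have : gt (-(((n:ℝ) - 6)/2)) t R =ᶠ[𝓝 s] fun s => (t^2 + s) ^ (-(((n:ℝ) - 6)/2)) := by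
    filter_upwards [isOpen_Ioi.mem_nhds hts, isOpen_Iio.mem_nhds hs] with r h1 h2
    rw [gt_eq hR h1, phi_one, one_mul]
    have : r < R^2 / 4 := h2
    rw [inv_mul_eq_div, div_le_iff₀ (by positivity)]; linarith
  rw [Lop3_congr this, Lop3_bub s (by linarith)]
  ring

theorem gt_bound (n : ℕ) : ∃ C : ℝ, 0 ≤ C ∧ ∀ t R : ℝ, 0 < t → t ≤ R → ∀ s, R^2/4 ≤ s →
    |Lop n (Lop n (Lop n (gt (-(((n:ℝ) - 6)/2)) t R))) s| ≤ C * (R^n)⁻¹ := by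
  obtain ⟨C, hC0, hC⟩ := gam_bound n (-(((n:ℝ) - 6)/2))
  refine ⟨C, hC0, fun t R ht hR s hs => ?_⟩
  have hR0 : 0 < R := ht.trans_le hR
  set q := (-(((n:ℝ) - 6)/2)) with hq
  have h1 := Lop3_scale (n := n) ((R^2)^q) (R^2)⁻¹ (gam q (t^2/R^2)) s
  have h2 : Lop n (Lop n (Lop n (gt q t R))) s = _ := h1
  rw [h2, ← mul_assoc, abs_mul]
  have h3 : (R^2)^q * ((R^2)⁻¹)^3 = (R^n)⁻¹ := by
    rw [rpow_sq hR0.le]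
    have : ((R^2)⁻¹)^3 = R ^ (-6:ℝ) := by
      rw [Real.rpow_neg hR0.le, show (6:ℝ) = ((6:ℕ):ℝ) by norm_num, Real.rpow_natCast]; field_simp
    rw [this, ← Real.rpow_add hR0, hq]
    have : 2 * -(((n:ℝ) - 6)/2) + -6 = -(n:ℝ) := by ring
    rw [this, Real.rpow_neg hR0.le, Real.rpow_natCast]
  rw [h3, abs_of_nonneg (by positivity), mul_comm]
  gcongr
  apply hC
  · constructor
    · positivity
    · rw [div_le_one (by positivity)]; gcongr
  · rw [inv_mul_eq_div, le_div_iff₀ (by positivity)]; linarith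

theorem IsSol.approx {u : E → ℝ} (h : IsSol u) : ∃ C : ℝ, 0 ≤ C ∧
    ∀ (x : E) (t R : ℝ), 0 < t → t ≤ R →
    |cst n * (∫ y, u y ^ pe n * (phi ((R^2)⁻¹ * ‖y - x‖^2) * (t^2 + ‖y - x‖^2) ^ (-(((n:ℝ) - 6)/2))))
      - 64 * cst n * ∫ y in Metric.ball x (R/2), u y * (t ^ 6 * (t^2 + ‖y - x‖^2) ^ (-(((n:ℝ) + 6)/2)))|
      ≤ C * ((R^n)⁻¹ * ∫ y in Metric.closedBall x R, u y) := by
  obtain ⟨C, hC0, hC⟩ := gt_bound n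
  refine ⟨C, hC0, fun x t R ht hR => ?_⟩
  have hR0 : 0 < R := ht.trans_le hR
  set q := (-(((n:ℝ) - 6)/2)) with hq
  have ht2 : -t^2 < 0 := by nlinarith
  have hT := h.test ht2 (gt_smooth (q := q) hR0) hR0.le (gt_zero hR0) x
  have hI := h.test_int ht2 (gt_smooth (q := q) hR0) hR0.le (gt_zero hR0) x
  have e1 : (fun y => u y ^ pe n * (phi ((R^2)⁻¹ * ‖y - x‖^2) * (t^2 + ‖y - x‖^2) ^ q))
      = fun y => u y ^ pe n * gt q t R (‖y - x‖^2) := by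
    funext y
    rw [gt_eq hR0 (ht2.trans_le (by positivity))]
  rw [e1, hT]
  rw [← integral_add_compl (s := Metric.ball x (R/2)) measurableSet_ball hI]
  have e2 : ∫ y in Metric.ball x (R/2), u y * -Lop n (Lop n (Lop n (gt q t R))) (‖y - x‖ ^ 2) =
      64 * cst n * ∫ y in Metric.ball x (R/2), u y * (t ^ 6 * (t^2 + ‖y - x‖^2) ^ (-(((n:ℝ) + 6)/2))) := by
    rw [← integral_const_mul]
    refine setIntegral_congr_fun measurableSet_ball fun y hy => ?_
    have hy' : ‖y - x‖ < R/2 := by simpa [dist_eq_norm] using hy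
    have : ‖y - x‖^2 < R^2/4 := by
      have : ‖y - x‖^2 < (R/2)^2 := by gcongr
      linarith
    rw [gt_near hR0 ht (by positivity) this]
    ring
  rw [e2, add_sub_cancel_left, ← Real.norm_eq_abs]
  set ind : E → ℝ := (Metric.closedBall x R).indicator fun y => C * (R^n)⁻¹ * u y with hind
  have hindI : Integrable ind := by
    refine (integrable_indicator_iff measurableSet_closedBall).2 ?_
    exact (h.smooth.continuous.continuousOn.integrableOn_compact (isCompact_closedBall x R)).const_mul _
  calc ‖∫ y in (Metric.ball x (R/2))ᶜ, u y * -Lop n (Lop n (Lop n (gt q t R))) (‖y - x‖ ^ 2)‖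
      ≤ ∫ y in (Metric.ball x (R/2))ᶜ, ind y := by
        refine norm_integral_le_of_norm_le hindI.integrableOn ?_
        filter_upwards [ae_restrict_mem measurableSet_ball.compl] with y hy
        have hy' : R/2 ≤ ‖y - x‖ := by simpa [dist_eq_norm] using hy
        have hu := h.pos y
        by_cases hin : y ∈ Metric.closedBall x R
        · rw [hind, indicator_of_mem hin, norm_mul, norm_neg, Real.norm_of_nonneg hu.le, mul_comm]
          gcongr
          apply hC t R ht hR
          have : (R/2)^2 ≤ ‖y - x‖^2 := by gcongr
          linarith
        · have : R < ‖y - x‖ := by simpa [dist_eq_norm] using hin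
          rw [hind, indicator_of_notMem hin, gt_far hR0 (by gcongr)]
          simp
    _ ≤ ∫ y, ind y := by
        refine setIntegral_le_integral hindI (Eventually.of_forall fun y => ?_)
        refine indicator_nonneg (fun y _ => ?_) y
        have := (h.pos y).le
        positivity
    _ = C * ((R^n)⁻¹ * ∫ y in Metric.closedBall x R, u y) := by
        rw [hind, integral_indicator measurableSet_closedBall, integral_const_mul]
        ring

/-- mass of the bubble -/
def mass (n : ℕ) : ℝ := ∫ z : EuclideanSpace ℝ (Fin n), (1 + ‖z‖^2) ^ (-(((n:ℝ) + 6)/2))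

theorem mass_int : Integrable (fun z : E => (1 + ‖z‖^2) ^ (-(((n:ℝ) + 6)/2))) := by
  have : Integrable (fun z : E => ((1:ℝ) + ‖z‖^2) ^ (-((n:ℝ) + 6)/2)) :=
    integrable_rpow_neg_one_add_norm_sq (by simp)
  convert this using 3
  ring

theorem mass_pos : 0 < mass n := by
  unfold mass
  apply integral_pos_of_integrable_nonneg_nonzero (x := 0) _ mass_int
  · intro z; positivity
  · simp
  · refine Continuous.rpow_const (by fun_prop) fun z => Or.inl (by positivity)

theorem delta_lim {u : E → ℝ} (hu : Continuous u) (x : E) {R : ℝ} (hR : 0 < R) :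
    Tendsto (fun t : ℝ => ∫ y in Metric.ball x (R/2), u y * (t ^ 6 * (t^2 + ‖y - x‖^2) ^ (-(((n:ℝ) + 6)/2))))
      (𝓝[>] 0) (𝓝 (u x * mass n)) := by
  set w : E → ℝ := (Metric.ball x (R/2)).indicator u with hw
  have hwm : Measurable w := hu.measurable.indicator measurableSet_ball
  have e : ∀ t > 0, ∫ y in Metric.ball x (R/2), u y * (t ^ 6 * (t^2 + ‖y - x‖^2) ^ (-(((n:ℝ) + 6)/2))) =
      ∫ z : E, w (x + t • z) * (1 + ‖z‖^2) ^ (-(((n:ℝ) + 6)/2)) := by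
    intro t ht
    rw [← integral_indicator measurableSet_ball]
    have e1 : ((Metric.ball x (R/2)).indicator fun y => u y * (t ^ 6 * (t^2 + ‖y - x‖^2) ^ (-(((n:ℝ) + 6)/2))))
      = fun y => w y * (t ^ 6 * (t^2 + ‖y - x‖^2) ^ (-(((n:ℝ) + 6)/2))) := by
      funext y
      by_cases hy : y ∈ Metric.ball x (R/2) <;> simp [hw, hy]
    rw [e1, ← integral_add_left_eq_self _ x]
    have := Measure.integral_comp_smul (volume : Measure E) (fun y : E => w (x + y) * (t ^ 6 * (t^2 + ‖(x + y) - x‖^2) ^ (-(((n:ℝ) + 6)/2)))) t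
    have e2 : (∫ y : E, w (x + y) * (t ^ 6 * (t^2 + ‖(x + y) - x‖^2) ^ (-(((n:ℝ) + 6)/2)))) =
      t^n * ∫ z : E, (fun y : E => w (x + y) * (t ^ 6 * (t^2 + ‖(x + y) - x‖^2) ^ (-(((n:ℝ) + 6)/2)))) (t • z) := by
      rw [this]
      simp only [finrank_euclideanSpace, Fintype.card_fin, smul_eq_mul]
      rw [abs_of_nonneg (by positivity), ← mul_assoc, mul_inv_cancel₀ (by positivity), one_mul]
    rw [e2, ← integral_const_mul]
    congr 1
    funext z
    simp only [add_sub_cancel_left, norm_smul, Real.norm_of_nonneg ht.le]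
    have e3 : t^2 + (t * ‖z‖)^2 = t^2 * (1 + ‖z‖^2) := by ring
    rw [e3, Real.mul_rpow (by positivity) (by positivity), rpow_sq ht.le]
    have e4 : t ^ (2 * -(((n:ℝ) + 6)/2)) = (t^n)⁻¹ * (t^6)⁻¹ := by
      have : 2 * -(((n:ℝ) + 6)/2) = -((n + 6 : ℕ) : ℝ) := by push_cast; ring
      rw [this, Real.rpow_neg ht.le, Real.rpow_natCast, pow_add, mul_inv]
    rw [e4]
    field_simp
  have hlim : Tendsto (fun t : ℝ => ∫ z : E, w (x + t • z) * (1 + ‖z‖^2) ^ (-(((n:ℝ) + 6)/2)))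
      (𝓝[>] 0) (𝓝 (∫ z : E, u x * (1 + ‖z‖^2) ^ (-(((n:ℝ) + 6)/2)))) := by
    obtain ⟨M, hM⟩ := (isCompact_closedBall x (R/2)).exists_bound_of_continuousOn hu.continuousOn
    have hwM : ∀ y, ‖w y‖ ≤ M := by
      intro y
      by_cases hy : y ∈ Metric.ball x (R/2)
      · rw [hw, indicator_of_mem hy]; exact hM y (Metric.ball_subset_closedBall hy)
      · rw [hw, indicator_of_notMem hy, norm_zero]
        exact (norm_nonneg _).trans (hM x (Metric.mem_closedBall_self (by positivity)))
    refine tendsto_integral_filter_of_dominated_convergence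
      (fun z : E => M * (1 + ‖z‖^2) ^ (-(((n:ℝ) + 6)/2))) ?_ ?_ (mass_int.const_mul _) ?_
    · refine Eventually.of_forall fun t => ?_
      have h1 : Measurable fun z : E => w (x + t • z) := hwm.comp (by fun_prop)
      have h2 : Measurable fun z : E => (1 + ‖z‖^2) ^ (-(((n:ℝ) + 6)/2)) := by fun_prop
      exact (h1.mul h2).aestronglyMeasurable
    · refine Eventually.of_forall fun t => Eventually.of_forall fun z => ?_
      rw [norm_mul, Real.norm_of_nonneg (show 0 ≤ (1 + ‖z‖^2) ^ (-(((n:ℝ) + 6)/2)) by positivity)]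
      gcongr
      exact hwM _
    · refine Eventually.of_forall fun z => ?_
      refine Tendsto.mul_const _ ?_
      have hwc : ContinuousAt w x := by
        have : w =ᶠ[𝓝 x] u := by
          filter_upwards [Metric.ball_mem_nhds x (show 0 < R/2 by positivity)] with y hy
          rw [hw, indicator_of_mem hy]
        exact hu.continuousAt.congr this.symm
      have hwx : w x = u x := by rw [hw, indicator_of_mem (Metric.mem_ball_self (by positivity))]
      rw [← hwx]
      refine hwc.tendsto.comp ?_
      have : Tendsto (fun t : ℝ => x + t • z) (𝓝 0) (𝓝 (x + (0:ℝ) • z)) :=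
        (by fun_prop : Continuous fun t : ℝ => x + t • z).tendsto 0
      rw [zero_smul, add_zero] at this
      exact this.mono_left nhdsWithin_le_nhds
  rw [integral_const_mul] at hlim
  refine hlim.congr' ?_
  filter_upwards [self_mem_nhdsWithin] with t ht
  exact (e t ht).symm

theorem IsSol.int_cut (hn : 7 ≤ n) {u : E → ℝ} (h : IsSol u) (x : E) {R : ℝ} (hR : 0 < R) :
    Integrable (fun y => u y ^ pe n * (phi ((R^2)⁻¹ * ‖y - x‖^2) * ‖y - x‖ ^ (-((n:ℝ) - 6)))) := by
  have hc : Continuous (fun z : E => u (z + x) ^ pe n * phi ((R^2)⁻¹ * ‖z‖^2)) := by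
    have h1 := h.cont_pow
    have h2 := phi_contDiff.continuous
    have h3 : Continuous (fun z : E => u (z + x) ^ pe n) := h1.comp (by fun_prop : Continuous fun z : E => z + x)
    fun_prop
  have hs : HasCompactSupport (fun z : E => u (z + x) ^ pe n * phi ((R^2)⁻¹ * ‖z‖^2)) := by
    refine HasCompactSupport.intro (isCompact_closedBall 0 R) fun y hy => ?_
    have : R < ‖y‖ := by simpa using hy
    have : 1 ≤ (R^2)⁻¹ * ‖y‖^2 := by
      rw [inv_mul_eq_div, le_div_iff₀ (by positivity), one_mul]; gcongr
    rw [phi_zero (by linarith), mul_zero]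
  have := ((kernel_locInt hn).integrable_smul_left_of_hasCompactSupport hc hs).comp_sub_right x
  refine this.congr (Eventually.of_forall fun y => ?_)
  simp [mul_assoc]

theorem IsSol.lhs_lim (hn : 7 ≤ n) {u : E → ℝ} (h : IsSol u) (x : E) {R : ℝ} (hR : 0 < R) :
    Tendsto (fun t : ℝ => ∫ y, u y ^ pe n * (phi ((R^2)⁻¹ * ‖y - x‖^2) * (t^2 + ‖y - x‖^2) ^ (-(((n:ℝ) - 6)/2))))
      (𝓝[>] 0) (𝓝 (∫ y, u y ^ pe n * (phi ((R^2)⁻¹ * ‖y - x‖^2) * ‖y - x‖ ^ (-((n:ℝ) - 6))))) := by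
  have hn' := nR hn
  have hne : ∀ᵐ y : E, y ≠ x := by
    have : Nontrivial E := by
      apply Module.nontrivial_of_finrank_pos (R := ℝ); simp; omega
    rw [ae_iff]; simp
  have hk : ∀ y : E, ‖y - x‖ ^ (-((n:ℝ) - 6)) = (‖y - x‖^2) ^ (-(((n:ℝ) - 6)/2)) := by
    intro y; rw [rpow_sq (norm_nonneg _)]; ring_nf
  refine tendsto_integral_filter_of_dominated_convergence
    (fun y => u y ^ pe n * (phi ((R^2)⁻¹ * ‖y - x‖^2) * ‖y - x‖ ^ (-((n:ℝ) - 6)))) ?_ ?_ (h.int_cut hn x hR) ?_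
  · refine Eventually.of_forall fun t => ?_
    have h1 := h.cont_pow.measurable
    have h2 := phi_contDiff.continuous.measurable
    exact (h1.mul ((h2.comp (by fun_prop)).mul (by fun_prop))).aestronglyMeasurable
  · refine Eventually.of_forall fun t => ?_
    filter_upwards [hne] with y hy
    have hu := (h.pos y).le
    have hp := phi_nonneg ((R^2)⁻¹ * ‖y - x‖^2)
    have hpos : 0 < ‖y - x‖ := norm_pos_iff.2 (sub_ne_zero.2 hy)
    rw [Real.norm_of_nonneg (by positivity), hk]
    gcongr ?_ * (?_ * ?_)
    apply Real.rpow_le_rpow_of_nonpos (by positivity) (by nlinarith) (by linarith)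
  · filter_upwards [hne] with y hy
    have hpos : 0 < ‖y - x‖ := norm_pos_iff.2 (sub_ne_zero.2 hy)
    rw [hk]
    refine Tendsto.const_mul _ (Tendsto.const_mul _ ?_)
    refine Tendsto.rpow_const ?_ (Or.inl (by positivity))
    have : Tendsto (fun t : ℝ => t^2 + ‖y - x‖^2) (𝓝 0) (𝓝 (0^2 + ‖y - x‖^2)) :=
      (by fun_prop : Continuous fun t : ℝ => t^2 + ‖y - x‖^2).tendsto 0
    simp only [ne_eq, OfNat.ofNat_ne_zero, not_false_eq_true, zero_pow, zero_add] at this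
    exact this.mono_left nhdsWithin_le_nhds

theorem IsSol.cut_lim (hn : 7 ≤ n) {u : E → ℝ} (h : IsSol u) (x : E) :
    Tendsto (fun R : ℝ => ∫ y, u y ^ pe n * (phi ((R^2)⁻¹ * ‖y - x‖^2) * ‖y - x‖ ^ (-((n:ℝ) - 6))))
      atTop (𝓝 (64 * mass n * u x)) := by
  obtain ⟨C, hC0, hC⟩ := h.approx
  have hc := cst_pos hn
  have key : ∀ R > 0, |cst n * (∫ y, u y ^ pe n * (phi ((R^2)⁻¹ * ‖y - x‖^2) * ‖y - x‖ ^ (-((n:ℝ) - 6))))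
      - 64 * cst n * (u x * mass n)| ≤ C * ((R^n)⁻¹ * ∫ y in Metric.closedBall x R, u y) := by
    intro R hR
    refine le_of_tendsto (((h.lhs_lim hn x hR).const_mul (cst n)).sub
      ((delta_lim h.smooth.continuous x hR).const_mul (64 * cst n))).abs ?_
    filter_upwards [Ioc_mem_nhdsGT hR] with t ht
    exact hC x t R ht.1 ht.2
  have h0 : Tendsto (fun R : ℝ => C / cst n * ((R^n)⁻¹ * ∫ y in Metric.closedBall x R, u y)) atTop (𝓝 0) := by
    simpa using (h.avg hn x).const_mul (C / cst n)
  rw [tendsto_iff_norm_sub_tendsto_zero]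
  refine squeeze_zero' (Eventually.of_forall fun R => norm_nonneg _) ?_ h0
  filter_upwards [eventually_gt_atTop 0] with R hR
  have := key R hR
  rw [show ∀ a b : ℝ, cst n * a - 64 * cst n * (u x * b) = cst n * (a - 64 * b * u x) by intros; ring,
    abs_mul, abs_of_pos hc] at this
  rw [Real.norm_eq_abs, div_mul_eq_mul_div, le_div_iff₀ hc, mul_comm]
  exact this

/-- The integral representation. -/
theorem IsSol.repr (hn : 7 ≤ n) {u : E → ℝ} (h : IsSol u) (x : E) :
    Integrable (fun y => u y ^ pe n * ‖y - x‖ ^ (-((n:ℝ) - 6))) ∧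
    ∫ y, u y ^ pe n * ‖y - x‖ ^ (-((n:ℝ) - 6)) = 64 * mass n * u x := by
  have hl := (h.cut_lim hn x).comp tendsto_natCast_atTop_atTop
  set F : ℕ → E → ℝ := fun k y => u y ^ pe n * (phi (((k:ℝ)^2)⁻¹ * ‖y - x‖^2) * ‖y - x‖ ^ (-((n:ℝ) - 6))) with hF
  have hl' : Tendsto (fun k => ∫ y, F k y) atTop (𝓝 (64 * mass n * u x)) := hl
  have m1 := h.cont_pow.measurable
  have m2 := phi_contDiff.continuous.measurable
  have hFm : ∀ k, Measurable (F k) := fun k => m1.mul ((m2.comp (by fun_prop)).mul (by fun_prop))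
  have hGm : Measurable (fun y => u y ^ pe n * ‖y - x‖ ^ (-((n:ℝ) - 6))) := m1.mul (by fun_prop)
  have hF0 : ∀ k y, 0 ≤ F k y := by
    intro k y
    have hu := (h.pos y).le
    have hp := phi_nonneg (((k:ℝ)^2)⁻¹ * ‖y - x‖^2)
    simp only [hF]; positivity
  have hG0 : ∀ y, 0 ≤ u y ^ pe n * ‖y - x‖ ^ (-((n:ℝ) - 6)) := by
    intro y
    have hu := (h.pos y).le
    positivity
  have hFG : ∀ y, Tendsto (fun k => F k y) atTop (𝓝 (u y ^ pe n * ‖y - x‖ ^ (-((n:ℝ) - 6)))) := by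
    intro y
    have hz : Tendsto (fun k : ℕ => ((k:ℝ)^2)⁻¹ * ‖y - x‖^2) atTop (𝓝 (0 * ‖y - x‖^2)) := by
      refine Tendsto.mul_const _ ?_
      exact tendsto_inv_atTop_zero.comp ((tendsto_pow_atTop (by norm_num)).comp tendsto_natCast_atTop_atTop)
    rw [zero_mul] at hz
    refine tendsto_const_nhds.congr' ?_
    filter_upwards [hz.eventually (Iio_mem_nhds (show (0:ℝ) < 1/4 by norm_num))] with k hk
    simp only [hF]
    rw [phi_one (le_of_lt hk), one_mul]
  have hInt : Integrable (fun y => u y ^ pe n * ‖y - x‖ ^ (-((n:ℝ) - 6))) := by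
    refine ⟨hGm.aestronglyMeasurable, ?_⟩
    rw [hasFiniteIntegral_iff_ofReal (Eventually.of_forall hG0)]
    have e1 : ∀ y, ENNReal.ofReal (u y ^ pe n * ‖y - x‖ ^ (-((n:ℝ) - 6))) =
        liminf (fun k => ENNReal.ofReal (F k y)) atTop := by
      intro y
      exact ((ENNReal.tendsto_ofReal (hFG y)).liminf_eq).symm
    simp only [e1]
    refine lt_of_le_of_lt (lintegral_liminf_le fun k => (hFm k).ennreal_ofReal) ?_
    have e2 : Tendsto (fun k => ∫⁻ y, ENNReal.ofReal (F k y)) atTop (𝓝 (ENNReal.ofReal (64 * mass n * u x))) := by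
      refine (ENNReal.tendsto_ofReal hl').congr' ?_
      filter_upwards [eventually_gt_atTop 0] with k hk
      exact ofReal_integral_eq_lintegral_ofReal (h.int_cut hn x (by exact_mod_cast hk)) (Eventually.of_forall (hF0 k))
    rw [e2.liminf_eq]
    exact ENNReal.ofReal_lt_top
  refine ⟨hInt, ?_⟩
  refine tendsto_nhds_unique ?_ hl'
  refine tendsto_integral_of_dominated_convergence _ (fun k => (hFm k).aestronglyMeasurable) hInt
    (fun k => Eventually.of_forall fun y => ?_) (Eventually.of_forall hFG)
  rw [Real.norm_of_nonneg (hF0 k y)]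
  have hu := (h.pos y).le
  have hp := phi_nonneg (((k:ℝ)^2)⁻¹ * ‖y - x‖^2)
  have hp1 := phi_le_one (((k:ℝ)^2)⁻¹ * ‖y - x‖^2)
  simp only [hF]
  gcongr
  exact mul_le_of_le_one_left (by positivity) hp1

end repr
end Bubble

open MeasureTheory Set Filter Topology
open scoped ContDiff
namespace Bubble

section inversionPart
variable {n : ℕ}

local notation "E" => EuclideanSpace ℝ (Fin n)

/-- inversion in the sphere of radius l about the origin -/
def iv (l : ℝ) (y : E) : E := (l / ‖y‖)^2 • y

theorem iv_eq (l : ℝ) (y : E) : iv l y = EuclideanGeometry.inversion 0 l y := by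
  simp [iv, EuclideanGeometry.inversion]

theorem norm_iv (l : ℝ) (y : E) : ‖iv l y‖ = l^2 / ‖y‖ := by
  have := EuclideanGeometry.dist_inversion_center (0:E) y l
  rwa [dist_zero_right, dist_zero_right, ← iv_eq] at this

theorem iv_iv {l : ℝ} (hl : 0 < l) (y : E) : iv l (iv l y) = y := by
  rw [iv_eq, iv_eq, EuclideanGeometry.inversion_inversion _ hl.ne']

theorem iv_ne {l : ℝ} (hl : 0 < l) {y : E} (hy : y ≠ 0) : iv l y ≠ 0 := by
  rw [← norm_pos_iff, norm_iv]
  have := norm_pos_iff.2 hy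
  positivity

theorem norm_iv_sub_iv {l : ℝ} {x y : E} (hx : x ≠ 0) (hy : y ≠ 0) :
    ‖iv l x - iv l y‖ = l^2 / (‖x‖ * ‖y‖) * ‖x - y‖ := by
  have := EuclideanGeometry.dist_inversion_inversion hx hy l
  simpa [← iv_eq, dist_eq_norm] using this

theorem iv_inj {l : ℝ} (hl : 0 < l) : Function.Injective (iv l : E → E) := by
  intro x y h
  rw [← iv_iv hl x, h, iv_iv hl]

theorem iv_deriv {l : ℝ} {x : E} (hx : x ≠ 0) :
    ∃ A : E →L[ℝ] E, HasFDerivAt (iv l) A x ∧ |A.det| = (l / ‖x‖)^(2*n) := by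
  have h := EuclideanGeometry.hasFDerivAt_inversion (R := l) hx
  have e : (EuclideanGeometry.inversion (0:E) l) = iv l := by funext y; rw [iv_eq]
  rw [e] at h
  refine ⟨_, h, ?_⟩
  have h1 := Submodule.det_reflection (K := (Submodule.span ℝ {x - 0})ᗮ)
  rw [ContinuousLinearMap.det, ContinuousLinearMap.toLinearMap_smul, LinearMap.det_smul]
  have h2 : LinearMap.det ((((Submodule.span ℝ {x - 0})ᗮ.reflection : E →L[ℝ] E)) : E →ₗ[ℝ] E)
      = (-1) ^ Module.finrank ℝ ((Submodule.span ℝ {x - 0})ᗮᗮ : Submodule ℝ E) := h1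
  rw [h2, abs_mul, abs_pow, abs_pow, abs_pow, abs_neg, abs_one, one_pow, mul_one, finrank_euclideanSpace,
    Fintype.card_fin, ← pow_mul, dist_zero_right, pow_mul, sq_abs, pow_mul]

theorem iv_deriv' (l : ℝ) :
    ∃ A : E → E →L[ℝ] E, ∀ x ≠ 0, HasFDerivAt (iv l) (A x) x ∧ |(A x).det| = (l / ‖x‖)^(2*n) := by
  choose! A hA using fun x (hx : x ≠ (0:E)) => iv_deriv (l := l) hx
  exact ⟨A, hA⟩

theorem iv_cov {l : ℝ} (hl : 0 < l) {S : Set E} (hS : MeasurableSet S) (h0 : (0:E) ∉ S) (f : E → ℝ) :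
    (IntegrableOn f (iv l '' S) ↔ IntegrableOn (fun w => (l / ‖w‖)^(2*n) * f (iv l w)) S) ∧
    ∫ x in iv l '' S, f x = ∫ w in S, (l / ‖w‖)^(2*n) * f (iv l w) := by
  obtain ⟨A, hA⟩ := iv_deriv' (n := n) l
  have hd : ∀ x ∈ S, HasFDerivWithinAt (iv l) (A x) S x := fun x hx =>
    (hA x (fun h => h0 (h ▸ hx))).1.hasFDerivWithinAt
  have hinj : InjOn (iv l) S := (iv_inj hl).injOn
  have key : ∀ x ∈ S, |(A x).det| • f (iv l x) = (l / ‖x‖)^(2*n) * f (iv l x) := fun x hx => by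
    rw [(hA x (fun h => h0 (h ▸ hx))).2, smul_eq_mul]
  constructor
  · rw [integrableOn_image_iff_integrableOn_abs_det_fderiv_smul volume hS hd hinj]
    exact integrableOn_congr_fun key hS
  · rw [integral_image_eq_integral_abs_det_fderiv_smul volume hS hd hinj]
    exact setIntegral_congr_fun hS key

theorem iv_image {l : ℝ} (hl : 0 < l) : iv l '' {w : E | l < ‖w‖} = {w : E | ‖w‖ < l} \ {0} := by
  ext w
  constructor
  · rintro ⟨z, hz, rfl⟩
    have hz' : l < ‖z‖ := hz
    refine ⟨?_, ?_⟩
    · show ‖iv l z‖ < l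
      rw [norm_iv, div_lt_iff₀ (by linarith)]; nlinarith
    · exact iv_ne hl (norm_pos_iff.1 (hl.trans hz'))
  · rintro ⟨h1, h2⟩
    have h1' : ‖w‖ < l := h1
    have h2' : 0 < ‖w‖ := norm_pos_iff.2 h2
    refine ⟨iv l w, ?_, iv_iv hl w⟩
    show l < ‖iv l w‖
    rw [norm_iv, lt_div_iff₀ h2']; nlinarith

def em (n : ℕ) : ℝ := (n:ℝ) - 6

theorem em_pos (hn : 7 ≤ n) : 0 < em n := by
  have := nR hn
  unfold em; linarith

theorem em_mul_pe (hn : 7 ≤ n) : em n * pe n = n + 6 := by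
  have := em_pos hn
  unfold em at *
  unfold pe; field_simp

/-- Kelvin transform -/
def kel (l : ℝ) (v : E → ℝ) (y : E) : ℝ := (l / ‖y‖) ^ em n * v (iv l y)

/-- solutions of the integral equation -/
structure Sol (v : E → ℝ) (κ : ℝ) : Prop where
  cont : Continuous v
  pos : ∀ y, 0 < v y
  kpos : 0 < κ
  int : ∀ y, Integrable (fun z => v z ^ pe n * ‖z - y‖ ^ (-em n))
  rep : ∀ y, ∫ z, v z ^ pe n * ‖z - y‖ ^ (-em n) = κ * v y

theorem kel_pos {l : ℝ} (hl : 0 < l) {v : E → ℝ} (hv : ∀ y, 0 < v y) {y : E} (hy : y ≠ 0) :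
    0 < kel l v y := by
  have := norm_pos_iff.2 hy
  have := hv (iv l y)
  unfold kel; positivity

def G2 (l : ℝ) (y w : E) : ℝ := (l / ‖w‖) ^ em n * ‖iv l w - y‖ ^ (-em n)

theorem G2_eq {l : ℝ} (hl : 0 < l) {y w : E} (hy : y ≠ 0) (hw : w ≠ 0) :
    (l / ‖y‖) ^ em n * ‖w - iv l y‖ ^ (-em n) = G2 l y w := by
  have hy' := norm_pos_iff.2 hy
  have hw' := norm_pos_iff.2 hw
  have h1 : ‖w - iv l y‖ = ‖w‖ / ‖y‖ * ‖iv l w - y‖ := by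
    have := norm_iv_sub_iv (l := l) (iv_ne hl hw) hy
    rw [iv_iv hl, norm_iv] at this
    rw [this]; field_simp
  rw [h1, Real.mul_rpow (by positivity) (norm_nonneg _), ← mul_assoc, G2, Real.rpow_neg (by positivity),
    ← Real.inv_rpow (by positivity), ← Real.mul_rpow (by positivity) (by positivity)]
  congr 2; field_simp

theorem G1_eq {l : ℝ} (hl : 0 < l) {y w : E} (hy : y ≠ 0) (hw : w ≠ 0) :
    (l / ‖y‖) ^ em n * G2 l (iv l y) w = ‖w - y‖ ^ (-em n) := by
  have hy' := norm_pos_iff.2 hy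
  have hw' := norm_pos_iff.2 hw
  rw [G2, norm_iv_sub_iv hw hy, Real.mul_rpow (by positivity) (norm_nonneg _), ← mul_assoc, ← mul_assoc,
    Real.rpow_neg (by positivity),
    ← Real.inv_rpow (by positivity), ← Real.mul_rpow (by positivity) (by positivity),
    ← Real.mul_rpow (by positivity) (by positivity)]
  have : l / ‖y‖ * (l / ‖w‖) * (l^2 / (‖w‖ * ‖y‖))⁻¹ = 1 := by field_simp
  rw [this]; simp

theorem kel_pow (hn : 7 ≤ n) {l : ℝ} (hl : 0 < l) {v : E → ℝ} (hv : ∀ y, 0 < v y) {w : E} (hw : w ≠ 0) (y : E) :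
    (l / ‖w‖)^(2*n) * (v (iv l w) ^ pe n * ‖iv l w - y‖ ^ (-em n)) = kel l v w ^ pe n * G2 l y w := by
  have hw' := norm_pos_iff.2 hw
  have hv' := (hv (iv l w)).le
  have hq : 0 < l / ‖w‖ := by positivity
  rw [kel, Real.mul_rpow (by positivity) hv', G2, ← Real.rpow_mul hq.le, em_mul_pe hn]
  have : (l / ‖w‖)^(2*n) = (l / ‖w‖) ^ ((n:ℝ) + 6) * (l / ‖w‖) ^ em n := by
    rw [← Real.rpow_add hq, ← Real.rpow_natCast]; congr 1; unfold em; push_cast; ring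
  rw [this]; ring

def Ext (n : ℕ) (l : ℝ) : Set (EuclideanSpace ℝ (Fin n)) := {w | l < ‖w‖}

theorem Ext_meas (l : ℝ) : MeasurableSet (Ext n l) := measurableSet_lt measurable_const measurable_norm

theorem Sol.split (hn : 7 ≤ n) {v : E → ℝ} {κ : ℝ} (h : Sol v κ) {l : ℝ} (hl : 0 < l) (y : E) :
    IntegrableOn (fun w => v w ^ pe n * ‖w - y‖ ^ (-em n)) (Ext n l) ∧
    IntegrableOn (fun w => kel l v w ^ pe n * G2 l y w) (Ext n l) ∧
    κ * v y = (∫ w in Ext n l, v w ^ pe n * ‖w - y‖ ^ (-em n)) + ∫ w in Ext n l, kel l v w ^ pe n * G2 l y w := by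
  have h0 : (0:E) ∉ Ext n l := by simp [Ext, hl.le]
  obtain ⟨c1, c2⟩ := iv_cov hl (Ext_meas l) h0 (fun w => v w ^ pe n * ‖w - y‖ ^ (-em n))
  have key : ∀ w ∈ Ext n l, (l / ‖w‖)^(2*n) * (v (iv l w) ^ pe n * ‖iv l w - y‖ ^ (-em n)) =
      kel l v w ^ pe n * G2 l y w := fun w hw => kel_pow hn hl h.pos (fun e => h0 (e ▸ hw)) y
  rw [integrableOn_congr_fun key (Ext_meas l)] at c1
  rw [setIntegral_congr_fun (Ext_meas l) key] at c2
  refine ⟨(h.int y).integrableOn, c1.1 (h.int y).integrableOn, ?_⟩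
  rw [← c2, ← h.rep y, ← integral_add_compl (Ext_meas l) (h.int y)]
  congr 1
  apply setIntegral_congr_set
  have : Nontrivial E := by
    apply Module.nontrivial_of_finrank_pos (R := ℝ); simp; omega
  have e1 : (iv l '' Ext n l) = {w : E | ‖w‖ < l} \ {0} := iv_image hl
  have e2 : (Ext n l)ᶜ = Metric.closedBall 0 l := by ext w; simp [Ext]
  have e3 : {w : E | ‖w‖ < l} = Metric.ball 0 l := by ext w; simp
  rw [e1, e2, e3]
  have a1 : (Metric.ball (0:E) l \ {0} : Set E) =ᵐ[volume] Metric.ball 0 l := sdiff_null_ae_eq_self (by simp)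
  refine (a1.trans ?_).symm
  symm
  rw [← Metric.closedBall_sdiff_sphere]
  exact (sdiff_null_ae_eq_self (Measure.addHaar_sphere volume (0:E) l)).symm

theorem Sol.split' (hn : 7 ≤ n) {v : E → ℝ} {κ : ℝ} (h : Sol v κ) {l : ℝ} (hl : 0 < l) {y : E} (hy : y ≠ 0) :
    IntegrableOn (fun w => v w ^ pe n * G2 l y w) (Ext n l) ∧
    IntegrableOn (fun w => kel l v w ^ pe n * ‖w - y‖ ^ (-em n)) (Ext n l) ∧
    κ * kel l v y = (∫ w in Ext n l, v w ^ pe n * G2 l y w) + ∫ w in Ext n l, kel l v w ^ pe n * ‖w - y‖ ^ (-em n) := by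
  have h0 : (0:E) ∉ Ext n l := by simp [Ext, hl.le]
  obtain ⟨a, b, c⟩ := h.split hn hl (iv l y)
  have k1 : ∀ w ∈ Ext n l, (l / ‖y‖) ^ em n * (v w ^ pe n * ‖w - iv l y‖ ^ (-em n)) = v w ^ pe n * G2 l y w := by
    intro w hw
    rw [← G2_eq hl hy (fun e => h0 (e ▸ hw))]; ring
  have k2 : ∀ w ∈ Ext n l, (l / ‖y‖) ^ em n * (kel l v w ^ pe n * G2 l (iv l y) w) = kel l v w ^ pe n * ‖w - y‖ ^ (-em n) := by
    intro w hw
    rw [← G1_eq hl hy (fun e => h0 (e ▸ hw))]; ring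
  refine ⟨(integrableOn_congr_fun k1 (Ext_meas l)).1 (a.const_mul _), (integrableOn_congr_fun k2 (Ext_meas l)).1 (b.const_mul _), ?_⟩
  rw [← setIntegral_congr_fun (Ext_meas l) k1, ← setIntegral_congr_fun (Ext_meas l) k2, integral_const_mul,
    integral_const_mul, ← mul_add, ← c, kel]
  ring

def KK (l : ℝ) (y w : E) : ℝ := ‖w - y‖ ^ (-em n) - G2 l y w

theorem Sol.diff (hn : 7 ≤ n) {v : E → ℝ} {κ : ℝ} (h : Sol v κ) {l : ℝ} (hl : 0 < l) {y : E} (hy : y ≠ 0) :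
    IntegrableOn (fun w => KK l y w * (v w ^ pe n - kel l v w ^ pe n)) (Ext n l) ∧
    κ * (v y - kel l v y) = ∫ w in Ext n l, KK l y w * (v w ^ pe n - kel l v w ^ pe n) := by
  obtain ⟨a1, a2, a3⟩ := h.split hn hl y
  obtain ⟨b1, b2, b3⟩ := h.split' hn hl hy
  have e : (fun w => KK l y w * (v w ^ pe n - kel l v w ^ pe n)) =
    fun w => ((v w ^ pe n * ‖w - y‖ ^ (-em n)) + (kel l v w ^ pe n * G2 l y w)) -
      ((v w ^ pe n * G2 l y w) + (kel l v w ^ pe n * ‖w - y‖ ^ (-em n))) := by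
    funext w; unfold KK; ring
  rw [e]
  refine ⟨(a1.add a2).sub (b1.add b2), ?_⟩
  rw [mul_sub, a3, b3, ← integral_add a1 a2, ← integral_add b1 b2]
  exact (integral_sub (a1.add a2) (b1.add b2)).symm

theorem KK_le {l : ℝ} (hl : 0 < l) (y w : E) : KK l y w ≤ ‖w - y‖ ^ (-em n) := by
  unfold KK G2
  have : 0 ≤ (l / ‖w‖) ^ em n * ‖iv l w - y‖ ^ (-em n) := by positivity
  linarith

theorem KK_pos (hn : 7 ≤ n) {l : ℝ} (hl : 0 < l) {y w : E} (hy : l < ‖y‖) (hw : l < ‖w‖) (hne : w ≠ y) : 0 < KK l y w := by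
  have hw' : 0 < ‖w‖ := hl.trans hw
  have h1 : 0 < ‖w - y‖ := norm_pos_iff.2 (sub_ne_zero.2 hne)
  have id : (‖w‖ / l * ‖iv l w - y‖)^2 - ‖w - y‖^2 = (‖w‖^2 - l^2) * (‖y‖^2 - l^2) / l^2 := by
    rw [mul_pow, norm_sub_sq_real, norm_sub_sq_real, norm_iv, iv, inner_smul_left]
    simp only [conj_trivial]
    field_simp
    ring
  have h2 : ‖w - y‖ < ‖w‖ / l * ‖iv l w - y‖ := by
    apply lt_of_pow_lt_pow_left₀ 2 (by positivity)
    have : 0 < (‖w‖^2 - l^2) * (‖y‖^2 - l^2) / l^2 := by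
      have a : 0 < ‖w‖^2 - l^2 := by nlinarith
      have b : 0 < ‖y‖^2 - l^2 := by nlinarith
      positivity
    linarith
  have h3 : G2 l y w = (‖w‖ / l * ‖iv l w - y‖) ^ (-em n) := by
    rw [G2, Real.mul_rpow (by positivity) (norm_nonneg _), Real.rpow_neg (x := ‖w‖ / l) (by positivity), ← Real.inv_rpow (by positivity), inv_div]
  unfold KK
  rw [h3, sub_pos]
  exact Real.rpow_lt_rpow_of_neg h1 h2 (by linarith [em_pos hn])

end inversionPart
end Bubble

open MeasureTheory Set Filter Topology
open scoped ContDiff ENNReal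
namespace Bubble

section narrowPart
variable {n : ℕ}

local notation "E" => EuclideanSpace ℝ (Fin n)

theorem ker_small (hn : 7 ≤ n) {R e : ℝ} (he : 0 < e) : ∃ η : ℝ≥0∞, 0 < η ∧ ∀ T : Set E,
    MeasurableSet T → (∀ w ∈ T, ‖w‖ ≤ R) → volume T < η → ∀ y : E, ‖y‖ ≤ R →
    IntegrableOn (fun w => ‖w - y‖ ^ (-em n)) T ∧ ∫ w in T, ‖w - y‖ ^ (-em n) ≤ e := by
  set F : E → ℝ := (Metric.closedBall 0 (2*R)).indicator (fun z => ‖z‖ ^ (-em n)) with hF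
  have hFI : Integrable F := by
    rw [hF, integrable_indicator_iff measurableSet_closedBall]
    exact (kernel_locInt hn).integrableOn_isCompact (isCompact_closedBall _ _)
  have hF0 : ∀ z, 0 ≤ F z := fun z => indicator_nonneg (fun z _ => by positivity) z
  have hFm : Measurable F := (by fun_prop : Measurable fun z : E => ‖z‖ ^ (-em n)).indicator measurableSet_closedBall
  have hfin : ∫⁻ z, ENNReal.ofReal (F z) ≠ ⊤ := by
    rw [← ofReal_integral_eq_lintegral_ofReal hFI (Eventually.of_forall hF0)]
    exact ENNReal.ofReal_ne_top
  obtain ⟨η, hη, h⟩ := exists_pos_setLIntegral_lt_of_measure_lt hfin (ε := ENNReal.ofReal e) (by simpa using he)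
  refine ⟨η, hη, fun T hT hTR hv y hy => ?_⟩
  have hI : IntegrableOn (fun w => F (w - y)) T := (hFI.comp_sub_right y).integrableOn
  have hc : ∀ w ∈ T, F (w - y) = ‖w - y‖ ^ (-em n) := by
    intro w hw
    rw [hF, indicator_of_mem]
    have := norm_sub_le w y
    have := hTR w hw
    simp only [Metric.mem_closedBall, dist_zero_right]; linarith
  refine ⟨(integrableOn_congr_fun hc hT).1 hI, ?_⟩
  rw [← setIntegral_congr_fun hT hc]
  rw [← ENNReal.ofReal_le_ofReal_iff he.le, ofReal_integral_eq_lintegral_ofReal hI (Eventually.of_forall fun w => hF0 _)]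
  have mp : MeasurePreserving (fun w : E => w - y) := measurePreserving_sub_right volume y
  have e1 : T = (fun w : E => w - y) ⁻¹' ((fun w : E => w + y) ⁻¹' T) := by
    ext w; simp
  have hmT : MeasurableSet ((fun w : E => w + y) ⁻¹' T) := (measurable_add_const y) hT
  have e2 := mp.setLIntegral_comp_preimage hmT (f := fun z => ENNReal.ofReal (F z)) (by fun_prop)
  rw [← e1] at e2
  rw [e2]
  refine (h _ ?_).le
  rw [measure_preimage_add_right]
  exact hv

theorem rpow_diff_le {a b M p : ℝ} (hb : 0 < b) (hab : b ≤ a) (haM : a ≤ M) (hp : 1 ≤ p) :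
    a ^ p - b ^ p ≤ p * M ^ (p - 1) * (a - b) := by
  have ha : 0 < a := hb.trans_le hab
  have h1 := one_add_mul_self_le_rpow_one_add (s := b / a - 1) (by linarith [div_pos hb ha]) hp
  rw [add_sub_cancel, Real.div_rpow hb.le ha.le, le_div_iff₀ (by positivity)] at h1
  have h2 : a ^ p = a ^ (p-1) * a := by
    rw [← Real.rpow_add_one ha.ne']; ring_nf
  have h3 : (1 + p * (b / a - 1)) * a ^ p = a ^ p + p * a ^ (p-1) * (b - a) := by
    rw [h2]; field_simp
  have h4 : a ^ (p-1) ≤ M ^ (p-1) := Real.rpow_le_rpow ha.le haM (by linarith)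
  have h5 : p * a ^ (p-1) * (a - b) ≤ p * M ^ (p-1) * (a - b) := by
    have : 0 ≤ a - b := by linarith
    gcongr
  rw [h3] at h1
  linarith

theorem iv_meas (l : ℝ) : Measurable (iv l : E → E) := by
  unfold iv
  fun_prop

theorem kel_meas (l : ℝ) {v : E → ℝ} (hv : Continuous v) : Measurable (kel l v) := by
  unfold kel
  exact (by fun_prop : Measurable fun y : E => (l / ‖y‖) ^ em n).mul (hv.measurable.comp (iv_meas l))

theorem ae_ne (hn : 7 ≤ n) (x : E) : ∀ᵐ y : E, y ≠ x := by
  have : Nontrivial E := by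
    apply Module.nontrivial_of_finrank_pos (R := ℝ); simp; omega
  rw [ae_iff]; simp

theorem kel_le (hn : 7 ≤ n) {v : E → ℝ} (hv : ∀ y, 0 < v y) {l M : ℝ} (hl : 0 < l) (hM : ∀ y : E, ‖y‖ ≤ l → v y ≤ M)
    {y : E} (hy : l ≤ ‖y‖) : kel l v y ≤ M := by
  have hy' : 0 < ‖y‖ := hl.trans_le hy
  have h1 : (l / ‖y‖) ^ em n ≤ 1 := Real.rpow_le_one (by positivity) ((div_le_one hy').2 hy) (em_pos hn).le
  have h2 : v (iv l y) ≤ M := by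
    apply hM; rw [norm_iv, div_le_iff₀ hy']; nlinarith
  have := hv (iv l y)
  unfold kel
  calc _ ≤ 1 * v (iv l y) := by gcongr
    _ ≤ M := by linarith

theorem Sol.narrow (hn : 7 ≤ n) {v : E → ℝ} {κ : ℝ} (h : Sol v κ) {R : ℝ} (hR : 0 < R) :
    ∃ η : ℝ≥0∞, 0 < η ∧ ∀ l, 0 < l → l ≤ R → (∀ y : E, l < ‖y‖ → v y < kel l v y → ‖y‖ ≤ R) →
      volume {y : E | l < ‖y‖ ∧ v y < kel l v y} < η → ∀ y : E, l < ‖y‖ → kel l v y ≤ v y := by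
  obtain ⟨M, hM⟩ := (isCompact_closedBall (0:E) R).exists_bound_of_continuousOn h.cont.continuousOn
  have hM' : ∀ y : E, ‖y‖ ≤ R → v y ≤ M := fun y hy => (le_abs_self _).trans (hM y (by simpa using hy))
  have hM0 : 0 < M := (h.pos 0).trans_le (hM' 0 (by simpa using hR.le))
  have hp := pe_gt hn
  have hκ := h.kpos
  set L := pe n * M ^ (pe n - 1) with hL
  have hL0 : 0 < L := by positivity
  obtain ⟨η, hη, hk⟩ := ker_small (n := n) hn (R := R) (e := κ / (2 * L)) (by positivity)
  refine ⟨η, hη, fun l hl hlR hsub hvol => ?_⟩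
  by_contra hcon
  push Not at hcon
  obtain ⟨y0, hy0, hy0'⟩ := hcon
  set T : Set E := {y : E | l < ‖y‖ ∧ v y < kel l v y} with hT
  have hTm : MeasurableSet T :=
    (Ext_meas l).inter (measurableSet_lt h.cont.measurable (kel_meas l h.cont))
  have hkM : ∀ y : E, l < ‖y‖ → kel l v y ≤ M := fun y hy =>
    kel_le hn h.pos hl (fun z hz => hM' z (hz.trans hlR)) hy.le
  set S := sSup ((fun y => kel l v y - v y) '' T) with hS
  have hbdd : BddAbove ((fun y => kel l v y - v y) '' T) := by
    refine ⟨M, ?_⟩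
    rintro _ ⟨y, hy, rfl⟩
    have := hkM y hy.1
    have := h.pos y
    simp only; linarith
  have hle : ∀ y ∈ T, kel l v y - v y ≤ S := fun y hy => le_csSup hbdd ⟨y, hy, rfl⟩
  have hS0 : 0 < S := by
    have := hle y0 ⟨hy0, hy0'⟩
    linarith
  have key : ∀ y ∈ T, kel l v y - v y ≤ S / 2 := by
    intro y hy
    have hy0 : y ≠ 0 := norm_pos_iff.1 (hl.trans hy.1)
    obtain ⟨d1, d2⟩ := h.diff hn hl hy0
    obtain ⟨k1, k2⟩ := hk T hTm (fun w hw => hsub w hw.1 hw.2) hvol y (hsub y hy.1 hy.2)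
    set ψ : E → ℝ := T.indicator (fun w => L * S * ‖w - y‖ ^ (-em n)) with hψ
    have hψI : Integrable ψ := (integrable_indicator_iff hTm).2 (k1.const_mul _)
    have hψ0 : ∀ w, 0 ≤ ψ w := fun w => indicator_nonneg (fun w _ => by positivity) w
    have b1 : ∫ w in Ext n l, -(KK l y w * (v w ^ pe n - kel l v w ^ pe n)) ≤ ∫ w in Ext n l, ψ w := by
      apply integral_mono_ae d1.neg hψI.integrableOn
      filter_upwards [ae_restrict_mem (Ext_meas l), ae_restrict_of_ae (ae_ne hn y)] with w hw hne
      have hw' : l < ‖w‖ := hw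
      have hK := KK_pos hn hl hy.1 hw' hne
      have hw0 : w ≠ 0 := norm_pos_iff.1 (hl.trans hw')
      have hkp := kel_pos hl h.pos hw0
      have hvp := h.pos w
      by_cases hwT : w ∈ T
      · rw [hψ, indicator_of_mem hwT]
        have c1 := rpow_diff_le hvp hwT.2.le (hkM w hw') hp.le
        have c2 := hle w hwT
        have c3 := KK_le hl y w
        have c4 : kel l v w ^ pe n - v w ^ pe n ≤ L * S := c1.trans (by gcongr)
        calc -(KK l y w * (v w ^ pe n - kel l v w ^ pe n)) = KK l y w * (kel l v w ^ pe n - v w ^ pe n) := by ring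
          _ ≤ KK l y w * (L * S) := by gcongr
          _ ≤ ‖w - y‖ ^ (-em n) * (L * S) := by gcongr
          _ = _ := by ring
      · rw [hψ, indicator_of_notMem hwT]
        have : kel l v w ≤ v w := by
          by_contra hc; exact hwT ⟨hw', not_le.1 hc⟩
        have : kel l v w ^ pe n ≤ v w ^ pe n := Real.rpow_le_rpow hkp.le this (by linarith)
        have : 0 ≤ KK l y w * (v w ^ pe n - kel l v w ^ pe n) := mul_nonneg hK.le (by linarith)
        simp only [Pi.neg_apply]
        linarith
    have b2 : ∫ w in Ext n l, ψ w ≤ ∫ w, ψ w := setIntegral_le_integral hψI (Eventually.of_forall hψ0)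
    have b3 : ∫ w, ψ w = L * S * ∫ w in T, ‖w - y‖ ^ (-em n) := by
      rw [hψ, integral_indicator hTm, integral_const_mul]
    have b4 : L * S * ∫ w in T, ‖w - y‖ ^ (-em n) ≤ L * S * (κ / (2 * L)) := by gcongr
    have b5 : L * S * (κ / (2 * L)) = κ * (S / 2) := by field_simp
    rw [integral_neg, ← d2] at b1
    have : κ * (kel l v y - v y) ≤ κ * (S/2) := by linarith
    exact le_of_mul_le_mul_left this hκ
  have : S ≤ S / 2 := by
    refine csSup_le (Set.Nonempty.image _ ⟨y0, hy0, hy0'⟩) ?_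
    rintro _ ⟨y, hy, rfl⟩
    exact key y hy
  linarith

theorem shell_vol (hn : 7 ≤ n) {l : ℝ} {η : ℝ≥0∞} (hη : 0 < η) :
    ∀ᶠ d in 𝓝[>] (0:ℝ), volume {y : E | l ≤ ‖y‖ ∧ ‖y‖ ≤ l + d} < η := by
  have : Nontrivial E := by
    apply Module.nontrivial_of_finrank_pos (R := ℝ); simp; omega
  have h := tendsto_measure_biInter_gt (μ := (volume : Measure E)) (s := fun d : ℝ => {y : E | l ≤ ‖y‖ ∧ ‖y‖ ≤ l + d}) (a := 0)
    (fun r _ => ?_) (fun i j _ hij y hy => ⟨hy.1, by linarith [hy.2]⟩) ⟨1, one_pos, ?_⟩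
  · have e : (⋂ r > (0:ℝ), {y : E | l ≤ ‖y‖ ∧ ‖y‖ ≤ l + r}) ⊆ Metric.sphere 0 l := by
      intro y hy
      simp only [mem_iInter] at hy
      have h1 := (hy 1 one_pos).1
      have h2 : ‖y‖ ≤ l := le_of_forall_pos_le_add fun r hr => (hy r hr).2
      simp; linarith
    have e2 : volume (⋂ r > (0:ℝ), {y : E | l ≤ ‖y‖ ∧ ‖y‖ ≤ l + r}) = 0 :=
      measure_mono_null e (Measure.addHaar_sphere _ _ _)
    rw [e2] at h
    exact h.eventually (Iio_mem_nhds hη)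
  · exact ((measurableSet_le measurable_const measurable_norm).inter
      (measurableSet_le measurable_norm measurable_const)).nullMeasurableSet
  · refine ne_top_of_le_ne_top (measure_closedBall_lt_top (x := (0:E)) (r := l + 1)).ne (measure_mono fun y hy => ?_)
    simpa using hy.2

theorem Sol.lower (hn : 7 ≤ n) {v : E → ℝ} {κ : ℝ} (h : Sol v κ) {r : ℝ} (hr : 0 < r) :
    ∃ c > 0, ∀ y : E, r ≤ ‖y‖ → c * ‖y‖ ^ (-em n) ≤ v y := by
  have hκ := h.kpos
  have hc : Continuous (fun z => v z ^ pe n) := h.cont.rpow_const fun z => Or.inl (h.pos z).ne'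
  have hci : IntegrableOn (fun z => v z ^ pe n) (Metric.closedBall 0 r) :=
    hc.continuousOn.integrableOn_compact (isCompact_closedBall _ _)
  have hI : 0 < ∫ z in Metric.closedBall (0:E) r, v z ^ pe n := by
    rw [setIntegral_pos_iff_support_of_nonneg_ae (Eventually.of_forall fun z => ?_) hci]
    · have : Function.support (fun z => v z ^ pe n) = univ := by
        ext z; have := h.pos z; simp; positivity
      rw [this, univ_inter]
      exact Metric.measure_closedBall_pos _ _ hr
    · have := (h.pos z).le
      simp only [Pi.zero_apply]; positivity
  refine ⟨2 ^ (-em n) * (∫ z in Metric.closedBall (0:E) r, v z ^ pe n) / κ, by positivity, fun y hy => ?_⟩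
  have hy' : 0 < ‖y‖ := hr.trans_le hy
  have h1 : ∫ z in Metric.closedBall (0:E) r, (2 * ‖y‖) ^ (-em n) * v z ^ pe n ≤ ∫ z in Metric.closedBall (0:E) r, v z ^ pe n * ‖z - y‖ ^ (-em n) := by
    apply integral_mono_ae (hci.const_mul _) (h.int y).integrableOn
    filter_upwards [ae_restrict_mem measurableSet_closedBall, ae_restrict_of_ae (ae_ne hn y)] with z hz hne
    have hz' : ‖z‖ ≤ r := by simpa using hz
    have h2 : 0 < ‖z - y‖ := norm_pos_iff.2 (sub_ne_zero.2 hne)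
    have h3 : ‖z - y‖ ≤ 2 * ‖y‖ := by linarith [norm_sub_le z y]
    have h4 : (2 * ‖y‖) ^ (-em n) ≤ ‖z - y‖ ^ (-em n) :=
      Real.rpow_le_rpow_of_nonpos h2 h3 (by linarith [em_pos hn])
    have := (h.pos z).le
    rw [mul_comm]
    gcongr
  have h2 : ∫ z in Metric.closedBall (0:E) r, v z ^ pe n * ‖z - y‖ ^ (-em n) ≤ κ * v y := by
    rw [← h.rep y]
    refine setIntegral_le_integral (h.int y) (Eventually.of_forall fun z => ?_)
    have := (h.pos z).le
    simp only [Pi.zero_apply]; positivity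
  rw [integral_const_mul, Real.mul_rpow (by positivity) hy'.le] at h1
  rw [div_mul_eq_mul_div, div_le_iff₀ hκ]
  linarith

def Good (v : E → ℝ) (l : ℝ) : Prop := ∀ y : E, l < ‖y‖ → kel l v y ≤ v y

theorem Sol.start (hn : 7 ≤ n) {v : E → ℝ} {κ : ℝ} (h : Sol v κ) : ∃ l0 > 0, ∀ l, 0 < l → l ≤ l0 → Good v l := by
  obtain ⟨η, hη, hN⟩ := h.narrow hn one_pos
  have hev := (shell_vol (n := n) hn (l := 0) hη).and (Ioc_mem_nhdsGT (one_pos (α := ℝ)))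
  obtain ⟨r, hr1, hr2⟩ := hev.exists
  obtain ⟨c, hc, hlow⟩ := h.lower hn hr2.1
  obtain ⟨M, hM⟩ := (isCompact_closedBall (0:E) 1).exists_bound_of_continuousOn h.cont.continuousOn
  have hM' : ∀ y : E, ‖y‖ ≤ 1 → v y ≤ M := fun y hy => (le_abs_self _).trans (hM y (by simpa using hy))
  have hm := em_pos hn
  have hM0 : 0 < M := (h.pos 0).trans_le (hM' 0 (by simp))
  have ht : Tendsto (fun l : ℝ => l ^ em n * M) (𝓝 0) (𝓝 (0 ^ em n * M)) :=
    ((Real.continuous_rpow_const hm.le).tendsto 0).mul_const M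
  rw [Real.zero_rpow hm.ne', zero_mul] at ht
  have h0 := ht.eventually (Iio_mem_nhds hc)
  obtain ⟨d, hd, hdd⟩ := Metric.eventually_nhds_iff.1 h0
  refine ⟨min (d/2) 1, by positivity, fun l hl hl0 => ?_⟩
  have hl1 : l ≤ 1 := hl0.trans (min_le_right _ _)
  have hld : l < d := by linarith [min_le_left (d/2) 1]
  have hlc : l ^ em n * M < c := hdd (by simpa [abs_of_pos hl] using hld)
  have hbig : ∀ y : E, l < ‖y‖ → v y < kel l v y → ‖y‖ ≤ r := by
    intro y hy hlt
    by_contra hcon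
    push Not at hcon
    have hy' : 0 < ‖y‖ := hl.trans hy
    have h1 := hlow y hcon.le
    have h2 : v (iv l y) ≤ M := hM' _ (by rw [norm_iv, div_le_iff₀ hy']; nlinarith)
    have h3 : kel l v y ≤ l ^ em n * M * ‖y‖ ^ (-em n) := by
      rw [kel, Real.div_rpow hl.le hy'.le, Real.rpow_neg hy'.le, div_eq_mul_inv]
      have : 0 ≤ l ^ em n * (‖y‖ ^ em n)⁻¹ := by positivity
      calc _ ≤ l ^ em n * (‖y‖ ^ em n)⁻¹ * M := by gcongr
        _ = _ := by ring
    have h4 : l ^ em n * M * ‖y‖ ^ (-em n) ≤ c * ‖y‖ ^ (-em n) := by gcongr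
    linarith
  refine hN l hl hl1 (fun y h1 h2 => (hbig y h1 h2).trans hr2.2) (lt_of_le_of_lt (measure_mono ?_) hr1)
  intro y hy
  exact ⟨norm_nonneg _, by simpa using hbig y hy.1 hy.2⟩

end narrowPart
end Bubble

open MeasureTheory Set Filter Topology
open scoped ContDiff ENNReal
namespace Bubble

section movingPart
variable {n : ℕ}

local notation "E" => EuclideanSpace ℝ (Fin n)

theorem kel_contAt (hn : 7 ≤ n) {v : E → ℝ} (hv : Continuous v) (l : ℝ) {y : E} (hy : y ≠ 0) :
    ContinuousAt (fun z : ℝ × E => kel z.1 v z.2) (l, y) := by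
  have hy' := norm_pos_iff.2 hy
  have h1 : ContinuousAt (fun z : ℝ × E => z.1 / ‖z.2‖) (l, y) :=
    continuousAt_fst.div continuousAt_snd.norm hy'.ne'
  unfold kel iv
  refine ContinuousAt.mul (h1.rpow_const (Or.inr (em_pos hn).le)) ?_
  exact hv.continuousAt.comp (f := fun z : ℝ × E => (z.1 / ‖z.2‖)^2 • z.2) ((h1.pow 2).smul continuousAt_snd)

theorem Sol.strict (hn : 7 ≤ n) {v : E → ℝ} {κ : ℝ} (h : Sol v κ) {l : ℝ} (hl : 0 < l) (hG : Good v l)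
    {y1 : E} (hy1 : l < ‖y1‖) (hs : kel l v y1 < v y1) (y : E) (hy : l < ‖y‖) : kel l v y < v y := by
  have hy0 : y ≠ 0 := norm_pos_iff.1 (hl.trans hy)
  obtain ⟨d1, d2⟩ := h.diff hn hl hy0
  have hp := pe_gt hn
  suffices hpos : 0 < ∫ w in Ext n l, KK l y w * (v w ^ pe n - kel l v w ^ pe n) by
    rw [← d2] at hpos
    have := pos_of_mul_pos_right hpos h.kpos.le
    linarith
  rw [setIntegral_pos_iff_support_of_nonneg_ae ?_ d1]
  · have hyy : y1 ≠ 0 := norm_pos_iff.1 (hl.trans hy1)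
    have hk : ContinuousAt (fun w => kel l v w) y1 :=
      (kel_contAt hn h.cont l hyy).comp (f := fun w : E => (l, w)) (by fun_prop)
    have hev : ∀ᶠ w in 𝓝 y1, kel l v w < v w ∧ l < ‖w‖ :=
      (hk.eventually_lt h.cont.continuousAt hs).and (continuousAt_const.eventually_lt continuous_norm.continuousAt hy1)
    obtain ⟨r, hr, hball⟩ := Metric.eventually_nhds_iff_ball.1 hev
    have : 0 < volume (Metric.ball y1 r \ {y}) := by
      have : Nontrivial E := ⟨y, 0, hy0⟩
      rw [measure_sdiff_null (by simp)]
      exact Metric.measure_ball_pos _ _ hr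
    refine this.trans_le (measure_mono fun w hw => ?_)
    obtain ⟨a, b⟩ := hball w hw.1
    refine ⟨?_, b⟩
    have hK := KK_pos hn hl hy b hw.2
    have hkp := kel_pos hl h.pos (norm_pos_iff.1 (hl.trans b))
    have := Real.rpow_lt_rpow hkp.le a (show 0 < pe n by linarith)
    have : 0 < KK l y w * (v w ^ pe n - kel l v w ^ pe n) := mul_pos hK (by linarith)
    exact this.ne'
  · filter_upwards [ae_restrict_mem (Ext_meas l), ae_restrict_of_ae (ae_ne hn y)] with w hw hne
    have hK := KK_pos hn hl hy hw hne
    have hkp := kel_pos hl h.pos (norm_pos_iff.1 (hl.trans hw))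
    have := Real.rpow_le_rpow hkp.le (hG w hw) (show 0 ≤ pe n by linarith)
    exact mul_nonneg hK.le (by linarith)

theorem ratio_lim (a m : ℝ) : Tendsto (fun t : ℝ => t ^ m * (t + a) ^ (-m)) atTop (𝓝 1) := by
  have h1 : Tendsto (fun t : ℝ => 1 + a / t) atTop (𝓝 (1 + 0)) :=
    tendsto_const_nhds.add (tendsto_const_nhds.div_atTop tendsto_id)
  rw [add_zero] at h1
  have h2 := h1.rpow_const (p := -m) (Or.inl one_ne_zero)
  rw [Real.one_rpow] at h2
  refine h2.congr' ?_
  filter_upwards [eventually_gt_atTop 0, eventually_gt_atTop (-a)] with t ht hta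
  have e : t + a = t * (1 + a / t) := by field_simp
  have hpos : 0 < 1 + a / t := by
    have : 0 < t + a := by linarith
    rw [e] at this
    exact pos_of_mul_pos_right this ht.le
  rw [e, Real.mul_rpow ht.le hpos.le, ← mul_assoc, ← Real.rpow_add ht]
  simp

theorem kel_norm {v : E → ℝ} {l : ℝ} (hl : 0 < l) {y : E} (hy : y ≠ 0) :
    ‖y‖ ^ em n * kel l v y = l ^ em n * v (iv l y) := by
  have hy' := norm_pos_iff.2 hy
  rw [kel, Real.div_rpow hl.le hy'.le]
  have : ‖y‖ ^ em n ≠ 0 := by positivity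
  field_simp

theorem Sol.far (hn : 7 ≤ n) {v : E → ℝ} {κ : ℝ} (h : Sol v κ) {l : ℝ} (hl : 0 < l) (hG : Good v l)
    {y1 : E} (hy1 : l < ‖y1‖) (hs : kel l v y1 < v y1) :
    ∃ c > 0, ∃ R > 0, ∀ y : E, R ≤ ‖y‖ → l ^ em n * v 0 + c ≤ ‖y‖ ^ em n * v y := by
  have hp := pe_gt hn
  have hm := em_pos hn
  have hκ := h.kpos
  have hyy : y1 ≠ 0 := norm_pos_iff.1 (hl.trans hy1)
  have hk : ContinuousAt (fun w => kel l v w) y1 :=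
    (kel_contAt hn h.cont l hyy).comp (f := fun w : E => (l, w)) (by fun_prop)
  have hkp1 := kel_pos hl h.pos hyy
  have hf : ContinuousAt (fun w => v w ^ pe n - kel l v w ^ pe n) y1 :=
    (h.cont.continuousAt.rpow_const (Or.inl (h.pos _).ne')).sub (hk.rpow_const (Or.inl hkp1.ne'))
  set f0 := (v y1 ^ pe n - kel l v y1 ^ pe n) / 2 with hf0
  have hf1 := Real.rpow_lt_rpow hkp1.le hs (show 0 < pe n by linarith)
  have hf0p : 0 < f0 := by rw [hf0]; linarith
  set l1 := (l + ‖y1‖) / 2 with hl1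
  have hll1 : l < l1 := by rw [hl1]; linarith
  have hev : ∀ᶠ w in 𝓝 y1, f0 < v w ^ pe n - kel l v w ^ pe n ∧ l1 < ‖w‖ :=
    (continuousAt_const.eventually_lt hf (by rw [hf0]; linarith)).and
      (continuousAt_const.eventually_lt continuous_norm.continuousAt (by rw [hl1]; linarith))
  obtain ⟨r, hr, hball⟩ := Metric.eventually_nhds_iff_ball.1 hev
  set R1 := ‖y1‖ + r with hR1
  set q := (l / l1) ^ em n with hq
  have hq1 : q < 1 := Real.rpow_lt_one (by positivity) ((div_lt_one (by linarith)).2 hll1) hm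
  set V := (volume (Metric.ball y1 r)).toReal with hV
  have hVp : 0 < V := ENNReal.toReal_pos (Metric.measure_ball_pos _ _ hr).ne' measure_ball_lt_top.ne
  have hlim : Tendsto (fun t : ℝ => t ^ em n * (t + R1) ^ (-em n) - q * (t ^ em n * (t + -l) ^ (-em n))) atTop (𝓝 (1 - q * 1)) :=
    (ratio_lim R1 (em n)).sub ((ratio_lim (-l) (em n)).const_mul q)
  have hev1 := hlim.eventually (Ioi_mem_nhds (show (1-q)/2 < 1 - q * 1 by linarith))
  set c := (1-q)/2 * f0 * V / κ / 2 with hc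
  have hq1' : 0 < 1 - q := by linarith
  have hcp : 0 < c := by positivity
  have hv0 : ∀ᶠ z in 𝓝 (0:E), v 0 - c / l ^ em n < v z := by
    refine continuousAt_const.eventually_lt h.cont.continuousAt ?_
    have : 0 < c / l ^ em n := by positivity
    linarith
  obtain ⟨d, hd, hvd⟩ := Metric.eventually_nhds_iff_ball.1 hv0
  obtain ⟨R, hR⟩ := eventually_atTop.1 (hev1.and ((eventually_gt_atTop R1).and (eventually_gt_atTop (l^2/d))))
  refine ⟨c, hcp, max R 1, by positivity, fun y hyR => ?_⟩
  obtain ⟨e1, e2, e3⟩ := hR ‖y‖ (le_trans (le_max_left _ _) hyR)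
  have hyp : 0 < ‖y‖ := lt_of_lt_of_le one_pos (le_trans (le_max_right _ _) hyR)
  have hly : l < ‖y‖ := by
    have : ‖y1‖ < R1 := by rw [hR1]; linarith
    linarith
  have hy0 : y ≠ 0 := norm_pos_iff.1 hyp
  obtain ⟨d1, d2⟩ := h.diff hn hl hy0
  set k0 := (‖y‖ + R1) ^ (-em n) - q * (‖y‖ + -l) ^ (-em n) with hk0
  have hk0' : (1-q)/2 < ‖y‖ ^ em n * k0 := by
    have : (1-q)/2 < _ := e1
    rw [hk0]; linarith
  have hym : 0 < ‖y‖ ^ em n := by positivity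
  have hk0p : 0 < k0 := pos_of_mul_pos_right (show 0 < ‖y‖ ^ em n * k0 by linarith) hym.le
  have hsub : Metric.ball y1 r ⊆ Ext n l := fun w hw => hll1.trans (hball w hw).2
  have i1 : ∫ w in Metric.ball y1 r, KK l y w * (v w ^ pe n - kel l v w ^ pe n) ≤ κ * (v y - kel l v y) := by
    rw [d2]
    refine setIntegral_mono_set d1 ?_ hsub.eventuallyLE
    filter_upwards [ae_restrict_mem (Ext_meas l), ae_restrict_of_ae (ae_ne hn y)] with w hw hne
    have hK := KK_pos hn hl hly hw hne
    have hkp := kel_pos hl h.pos (norm_pos_iff.1 (hl.trans hw))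
    have := Real.rpow_le_rpow hkp.le (hG w hw) (show 0 ≤ pe n by linarith)
    exact mul_nonneg hK.le (by linarith)
  have i2 : k0 * f0 * V ≤ ∫ w in Metric.ball y1 r, KK l y w * (v w ^ pe n - kel l v w ^ pe n) := by
    have : k0 * f0 * V = ∫ w in Metric.ball y1 r, k0 * f0 := by
      rw [setIntegral_const, smul_eq_mul, Measure.real]; ring
    rw [this]
    refine setIntegral_mono_on (integrableOn_const measure_ball_lt_top.ne) (d1.mono_set hsub) measurableSet_ball fun w hw => ?_
    obtain ⟨a, b⟩ := hball w hw
    have hwn : ‖w‖ < R1 := by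
      have : ‖w - y1‖ < r := by simpa [dist_eq_norm] using hw
      have := norm_le_norm_add_norm_sub' w y1
      rw [hR1]; linarith
    have hwp : 0 < ‖w‖ := by linarith
    have hK : k0 ≤ KK l y w := by
      rw [hk0, KK, G2]
      have t1 : 0 < ‖w - y‖ := by
        refine norm_pos_iff.2 (sub_ne_zero.2 fun e => ?_)
        rw [e] at hwn; linarith
      have t2 : ‖w - y‖ ≤ ‖y‖ + R1 := by linarith [norm_sub_le w y]
      have t3 : (‖y‖ + R1) ^ (-em n) ≤ ‖w - y‖ ^ (-em n) :=
        Real.rpow_le_rpow_of_nonpos t1 t2 (by linarith)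
      have t4 : (l / ‖w‖) ^ em n ≤ q := by
        rw [hq]; gcongr
      have t5 : ‖y‖ + -l ≤ ‖iv l w - y‖ := by
        have : ‖iv l w‖ ≤ l := by rw [norm_iv, div_le_iff₀ hwp]; nlinarith
        have := norm_le_norm_add_norm_sub' y (iv l w)
        rw [norm_sub_rev] at this
        linarith
      have t6 : ‖iv l w - y‖ ^ (-em n) ≤ (‖y‖ + -l) ^ (-em n) :=
        Real.rpow_le_rpow_of_nonpos (by linarith) t5 (by linarith)
      have t7 : (l / ‖w‖) ^ em n * ‖iv l w - y‖ ^ (-em n) ≤ q * (‖y‖ + -l) ^ (-em n) := by gcongr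
      linarith
    exact mul_le_mul hK a.le hf0p.le (hk0p.le.trans hK)
  have i3 : 2 * c ≤ ‖y‖ ^ em n * (v y - kel l v y) := by
    have : k0 * f0 * V / κ ≤ v y - kel l v y := by
      rw [div_le_iff₀ hκ]; linarith
    calc 2 * c = (1-q)/2 * f0 * V / κ := by rw [hc]; ring
      _ ≤ (‖y‖ ^ em n * k0) * f0 * V / κ := by gcongr
      _ = ‖y‖ ^ em n * (k0 * f0 * V / κ) := by ring
      _ ≤ _ := by gcongr
  rw [mul_sub, kel_norm hl hy0] at i3
  have i4 : v 0 - c / l ^ em n < v (iv l y) := by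
    apply hvd
    rw [mem_ball_zero_iff, norm_iv, div_lt_iff₀ hyp]
    rw [div_lt_iff₀ hd] at e3
    linarith
  have i5 : l ^ em n * v 0 - c ≤ l ^ em n * v (iv l y) := by
    have hlm : 0 < l ^ em n := by positivity
    calc l ^ em n * v 0 - c = l ^ em n * (v 0 - c / l ^ em n) := by field_simp
      _ ≤ _ := by gcongr
  linarith

theorem Sol.isopen (hn : 7 ≤ n) {v : E → ℝ} {κ : ℝ} (h : Sol v κ) {l : ℝ} (hl : 0 < l) (hG : Good v l)
    {y1 : E} (hy1 : l < ‖y1‖) (hs : kel l v y1 < v y1) :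
    ∃ δ > 0, ∀ μ, l ≤ μ → μ < l + δ → Good v μ := by
  have hm := em_pos hn
  obtain ⟨η, hη, hN⟩ := h.narrow hn (show 0 < l + 1 by linarith)
  have hev := (shell_vol (n := n) hn (l := l) hη).and (Ioc_mem_nhdsGT (one_pos (α := ℝ)))
  obtain ⟨d, hd1, hd2⟩ := hev.exists
  obtain ⟨c, hc, R, hR, hfar⟩ := h.far hn hl hG hy1 hs
  -- far region
  have hcont : ContinuousAt (fun z : ℝ × E => z.1 ^ em n * v (z.1^2 • z.2)) (l, 0) := by
    refine (continuousAt_fst.rpow_const (Or.inr hm.le)).mul ?_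
    exact h.cont.continuousAt.comp (f := fun z : ℝ × E => z.1^2 • z.2) (by fun_prop)
  have hev1 : ∀ᶠ z in 𝓝 ((l, 0) : ℝ × E), z.1 ^ em n * v (z.1^2 • z.2) < l ^ em n * v 0 + c := by
    refine hcont.eventually_lt continuousAt_const ?_
    simp; exact hc
  rw [nhds_prod_eq] at hev1
  obtain ⟨p1, hp1, p2, hp2, hpp⟩ := eventually_prod_iff.1 hev1
  obtain ⟨s, hs0, hsb⟩ := Metric.eventually_nhds_iff_ball.1 hp2
  set R2 := max R (2 / s) with hR2
  have hR2R : R ≤ R2 := le_max_left _ _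
  have hR2s : 2 / s ≤ R2 := le_max_right _ _
  have hfar2 : ∀ μ, 0 < μ → p1 μ → ∀ y : E, R2 ≤ ‖y‖ → kel μ v y ≤ v y := by
    intro μ hμ hpμ y hy
    have hyp : 0 < ‖y‖ := by linarith
    have hy0 : y ≠ 0 := norm_pos_iff.1 hyp
    have h1 := hfar y (by linarith)
    have h2 : p2 ((‖y‖^2)⁻¹ • y) := by
      apply hsb
      rw [mem_ball_zero_iff, norm_smul, norm_inv, norm_pow, norm_norm]
      have : (‖y‖^2)⁻¹ * ‖y‖ = 1 / ‖y‖ := by field_simp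
      rw [this, div_lt_iff₀ hyp]
      have : 2 / s ≤ ‖y‖ := by linarith
      rw [div_le_iff₀ hs0] at this
      linarith
    have h3 := hpp hpμ h2
    simp only at h3
    have h4 : μ^2 • (‖y‖^2)⁻¹ • y = iv μ y := by
      rw [iv, smul_smul, div_pow, div_eq_mul_inv]
    rw [h4, ← kel_norm hμ hy0] at h3
    have hym : 0 < ‖y‖ ^ em n := by positivity
    exact le_of_mul_le_mul_left (h3.le.trans h1) hym
  -- middle region
  set A : Set E := {y | l + d ≤ ‖y‖} ∩ Metric.closedBall 0 R2 with hA
  have hAc : IsCompact A := (isCompact_closedBall _ _).inter_left (isClosed_le continuous_const continuous_norm)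
  have hmid : ∀ᶠ μ in 𝓝 l, ∀ y ∈ A, kel μ v y < v y := by
    refine hAc.eventually_forall_of_forall_eventually fun y hy => ?_
    have hly : l < ‖y‖ := by
      have : l + d ≤ ‖y‖ := hy.1
      linarith [hd2.1]
    have hy0 : y ≠ 0 := norm_pos_iff.1 (hl.trans hly)
    exact (kel_contAt hn h.cont l hy0).eventually_lt (h.cont.continuousAt.comp continuousAt_snd)
      (h.strict hn hl hG hy1 hs y hly)
  obtain ⟨δ, hδ, hδe⟩ := Metric.eventually_nhds_iff.1 (hp1.and hmid)
  refine ⟨min δ 1, by positivity, fun μ hμ1 hμ2 => ?_⟩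
  have hμδ : μ < l + δ := by linarith [min_le_left δ 1]
  have hμ3 : μ ≤ l + 1 := by linarith [min_le_right δ 1]
  have hμ : 0 < μ := hl.trans_le hμ1
  obtain ⟨q1, q2⟩ := hδe (y := μ) (by rw [Real.dist_eq, abs_of_nonneg (by linarith)]; linarith)
  have hbad : ∀ y : E, μ < ‖y‖ → v y < kel μ v y → ‖y‖ ≤ l + d := by
    intro y h1 h2
    by_contra hcon
    push Not at hcon
    by_cases hb : R2 ≤ ‖y‖
    · linarith [hfar2 μ hμ q1 y hb]
    · have := q2 y ⟨hcon.le, by simpa using (not_le.1 hb).le⟩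
      linarith
  refine hN μ hμ hμ3 (fun y h1 h2 => (hbad y h1 h2).trans (by linarith [hd2.2])) (lt_of_le_of_lt (measure_mono ?_) hd1)
  intro y hy
  exact ⟨hμ1.trans hy.1.le, hbad y hy.1 hy.2⟩

theorem kel_symm {v : E → ℝ} {l : ℝ} (hl : 0 < l) (hE : ∀ y : E, l < ‖y‖ → kel l v y = v y) :
    ∀ y : E, y ≠ 0 → kel l v y = v y := by
  intro y hy
  have hyp := norm_pos_iff.2 hy
  rcases lt_trichotomy ‖y‖ l with hlt | heq | hgt
  · have h1 : l < ‖iv l y‖ := by rw [norm_iv, lt_div_iff₀ hyp]; nlinarith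
    have h2 := hE _ h1
    rw [kel, iv_iv hl, norm_iv] at h2
    rw [kel, ← h2, ← mul_assoc, ← Real.mul_rpow (by positivity) (by positivity)]
    have : l / ‖y‖ * (l / (l^2 / ‖y‖)) = 1 := by field_simp
    rw [this]; simp
  · rw [kel, iv, heq, div_self hl.ne']; simp
  · exact hE y hgt

theorem Sol.dichotomy (hn : 7 ≤ n) {v : E → ℝ} {κ : ℝ} (h : Sol v κ) :
    (∀ l > 0, Good v l) ∨ ∃ l > 0, ∀ y : E, y ≠ 0 → kel l v y = v y := by
  by_cases hall : ∀ l > 0, Good v l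
  · exact Or.inl hall
  right
  push Not at hall
  obtain ⟨b, hb, hbad⟩ := hall
  set S : Set ℝ := {l | 0 < l ∧ ∀ μ, 0 < μ → μ ≤ l → Good v μ} with hS
  obtain ⟨l0, hl0, hst⟩ := h.start hn
  have hl0S : l0 ∈ S := ⟨hl0, hst⟩
  have hbdd : BddAbove S := by
    refine ⟨b, fun l hl => ?_⟩
    by_contra hcon
    exact hbad (hl.2 b hb (not_le.1 hcon).le)
  set L := sSup S with hL
  have hLp : 0 < L := hl0.trans_le (le_csSup hbdd hl0S)
  have hlt : ∀ μ, 0 < μ → μ < L → Good v μ := by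
    intro μ hμ hμL
    obtain ⟨l, hl, hμl⟩ := exists_lt_of_lt_csSup ⟨l0, hl0S⟩ hμL
    exact hl.2 μ hμ hμl.le
  have hGL : Good v L := by
    intro y hy
    have hy0 : y ≠ 0 := norm_pos_iff.1 (hLp.trans hy)
    have hk : ContinuousAt (fun μ => kel μ v y) L :=
      (kel_contAt hn h.cont L hy0).comp (f := fun μ : ℝ => (μ, y)) (by fun_prop)
    refine le_of_tendsto (hk.tendsto.mono_left (nhdsWithin_le_nhds (s := Iio L))) ?_
    filter_upwards [Ioo_mem_nhdsLT hLp] with μ hμ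
    exact hlt μ hμ.1 hμ.2 y (hμ.2.trans hy)
  refine ⟨L, hLp, kel_symm hLp fun y hy => ?_⟩
  by_contra hne
  have hs : kel L v y < v y := lt_of_le_of_ne (hGL y hy) hne
  obtain ⟨δ, hδ, hopen⟩ := h.isopen hn hLp hGL hy hs
  have : L + δ/2 ∈ S := by
    refine ⟨by linarith, fun μ hμ hμ2 => ?_⟩
    rcases lt_or_ge μ L with h1 | h1
    · exact hlt μ hμ h1
    · exact hopen μ h1 (by linarith)
  have := le_csSup hbdd this
  linarith

end movingPart
end Bubble

open MeasureTheory Set Filter Topology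
open scoped ContDiff
namespace Bubble

section globalPart
variable {n : ℕ}

local notation "E" => EuclideanSpace ℝ (Fin n)

theorem IsSol.toSol (hn : 7 ≤ n) {u : E → ℝ} (h : IsSol u) (x : E) :
    Sol (fun z => u (z + x)) (64 * mass n) where
  cont := h.smooth.continuous.comp (by fun_prop)
  pos := fun y => h.pos _
  kpos := by have := mass_pos (n := n); positivity
  int := fun y => by
    have := ((h.repr hn (y + x)).1).comp_add_right x
    refine this.congr (Eventually.of_forall fun z => ?_)
    simp only [em, add_sub_add_right_eq_sub]
  rep := fun y => by
    have h1 := (h.repr hn (y + x)).2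
    rw [← integral_add_right_eq_self _ x] at h1
    rw [← h1]
    simp only [em, add_sub_add_right_eq_sub]

/-- every dilation about the centre x is good -/
def AllGood (u : E → ℝ) (x : E) : Prop := ∀ l > 0, Good (fun z => u (z + x)) l

/-- exact Kelvin symmetry about the centre x -/
def Symm (u : E → ℝ) (x : E) (l : ℝ) : Prop :=
  0 < l ∧ ∀ y : E, y ≠ 0 → ‖y‖ ^ em n * u (y + x) = l ^ em n * u (iv l y + x)

theorem IsSol.dich (hn : 7 ≤ n) {u : E → ℝ} (h : IsSol u) (x : E) :
    AllGood u x ∨ ∃ l, Symm u x l := by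
  rcases (h.toSol hn x).dichotomy hn with h1 | ⟨l, hl, h1⟩
  · exact Or.inl h1
  · refine Or.inr ⟨l, hl, fun y hy => ?_⟩
    have := kel_norm (v := fun z => u (z + x)) hl hy
    rw [h1 y hy] at this
    exact this

theorem AllGood.bound {u : E → ℝ} {x : E} (h : AllGood u x) {l : ℝ} (hl : 0 < l) {y : E} (hy : l < ‖y‖) :
    l ^ em n * u (iv l y + x) ≤ ‖y‖ ^ em n * u (y + x) := by
  have hy0 : y ≠ 0 := norm_pos_iff.1 (hl.trans hy)
  have := kel_norm (v := fun z => u (z + x)) hl hy0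
  rw [← this]
  have h1 := h l hl y hy
  gcongr

theorem AllGood.not_symm (hn : 7 ≤ n) {u : E → ℝ} (hu : Continuous u) (hpos : ∀ y, 0 < u y) {x : E}
    (h : AllGood u x) {x' : E} {l' : ℝ} (h' : Symm u x' l') : False := by
  have hm := em_pos hn
  obtain ⟨hl', h'⟩ := h'
  -- upper bound on the unit ball around the second centre
  obtain ⟨C, hC⟩ := (isCompact_closedBall x' l').bddAbove_image (f := u) hu.continuousOn
  have hC' : ∀ w, ‖w‖ ≤ l' → u (w + x') ≤ C := fun w hw =>
    hC ⟨w + x', by simpa [Metric.mem_closedBall, dist_eq_norm] using hw, rfl⟩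
  have hC0 : 0 < C := (hpos (0 + x')).trans_le (hC' 0 (by simpa using hl'.le))
  -- lower bound near the first centre
  obtain ⟨d, hd, hd'⟩ : ∃ d > 0, ∀ w : E, ‖w‖ < d → u x / 2 < u (w + x) := by
    have : ContinuousAt (fun w => u (w + x)) 0 := (hu.comp (by fun_prop)).continuousAt
    have h2 : ∀ᶠ w in 𝓝 (0:E), u x / 2 < u (w + x) := by
      apply this.eventually (lt_mem_nhds _)
      have := hpos x
      simp; linarith
    obtain ⟨d, hd, hd'⟩ := Metric.eventually_nhds_iff.1 h2
    exact ⟨d, hd, fun w hw => hd' (by simpa using hw)⟩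
  -- choose l with l^m u(x)/2 > 2^m l'^m C
  have ht : Tendsto (fun l : ℝ => l ^ em n * (u x / 2)) atTop atTop :=
    (tendsto_rpow_atTop hm).atTop_mul_const (by have := hpos x; positivity)
  obtain ⟨l, hlb, hl⟩ := ((ht.eventually_gt_atTop (2 ^ em n * (l' ^ em n * C))).and
    (eventually_gt_atTop 0)).exists
  haveI : Nontrivial E := by
    haveI : Nonempty (Fin n) := ⟨⟨0, by omega⟩⟩
    infer_instance
  obtain ⟨z, hz⟩ := NormedSpace.exists_lt_norm ℝ E
    (l + l^2 / d + l' + 2 * ‖x'-x‖ + ‖x‖ + 2 * ‖x'‖)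
  have hl2 : 0 ≤ l^2/d := by positivity
  have e1 : ‖z‖ ≤ ‖z - x‖ + ‖x‖ := by simpa using norm_add_le (z - x) x
  have e2 : ‖z‖ ≤ ‖z - x'‖ + ‖x'‖ := by simpa using norm_add_le (z - x') x'
  have e3 : ‖z - x‖ ≤ ‖z - x'‖ + ‖x' - x‖ := by simpa using norm_add_le (z - x') (x' - x)
  have p1 := norm_nonneg x
  have p2 := norm_nonneg x'
  have p3 := norm_nonneg (x' - x)
  have f1 : l < ‖z - x‖ := by linarith
  have f2 : l^2 / d < ‖z - x‖ := by linarith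
  have f3 : l' < ‖z - x'‖ := by linarith
  have f4 : ‖z - x‖ ≤ 2 * ‖z - x'‖ := by linarith
  have b1 := h.bound hl f1
  have b2 := h' (z - x') (norm_pos_iff.1 (hl'.trans f3))
  rw [sub_add_cancel] at b1 b2
  have g1 : u x / 2 < u (iv l (z - x) + x) := by
    apply hd'
    rw [norm_iv, div_lt_iff₀ (hl.trans f1)]
    rw [div_lt_iff₀ hd] at f2
    linarith
  have g2 : u (iv l' (z - x') + x') ≤ C := by
    apply hC'
    rw [norm_iv, div_le_iff₀ (hl'.trans f3)]
    nlinarith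
  have k1 : ‖z - x‖ ^ em n * u z ≤ 2 ^ em n * (‖z - x'‖ ^ em n * u z) := by
    rw [← mul_assoc, ← Real.mul_rpow (by norm_num) (norm_nonneg _)]
    have := hpos z
    gcongr
  rw [b2] at k1
  have k2 : 2 ^ em n * (l' ^ em n * u (iv l' (z - x') + x')) ≤ 2 ^ em n * (l' ^ em n * C) := by gcongr
  have k3 : l ^ em n * (u x / 2) ≤ l ^ em n * u (iv l (z - x) + x) := by gcongr
  linarith

theorem const_of_allGood (hn : 7 ≤ n) {u : E → ℝ}
    (h : ∀ x, AllGood u x) (a b : E) : u a ≤ u b := by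
  by_cases hab : a = b
  · rw [hab]
  have hm := em_pos hn
  have key : ∀ t : ℝ, 0 < t → t < 1 → t ^ em n * u a ≤ u b := by
    intro t ht ht1
    have h1 : 0 < 1 - t^2 := by nlinarith
    set x : E := b + (1 - t^2)⁻¹ • (a - b) with hx
    set y : E := b - x with hy
    have hy' : y = -((1 - t^2)⁻¹ • (a - b)) := by rw [hy, hx]; abel
    have hyn : 0 < ‖y‖ := by
      rw [hy', norm_neg, norm_pos_iff]
      exact smul_ne_zero (inv_ne_zero h1.ne') (sub_ne_zero.2 hab)
    have hb := (h x).bound (l := t * ‖y‖) (by positivity) (y := y) (by nlinarith)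
    have hiv : iv (t * ‖y‖) y + x = a := by
      rw [iv, mul_div_assoc, div_self hyn.ne', mul_one]
      have : x = b - y := by rw [hy]; abel
      rw [this]
      have h2 : t^2 • y + (b - y) = b - (1 - t^2) • y := by rw [sub_smul, one_smul]; abel
      rw [h2, hy', smul_neg, smul_smul, mul_inv_cancel₀ h1.ne', one_smul]; abel
    rw [hiv, hy, sub_add_cancel, ← hy, Real.mul_rpow ht.le hyn.le] at hb
    have : 0 < ‖y‖ ^ em n := by positivity
    have h3 : ‖y‖ ^ em n * (t ^ em n * u a) ≤ ‖y‖ ^ em n * u b := by linarith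
    exact le_of_mul_le_mul_left h3 this
  have hlim : Tendsto (fun t : ℝ => t ^ em n * u a) (𝓝[<] 1) (𝓝 (1 ^ em n * u a)) := by
    apply Tendsto.mono_left _ nhdsWithin_le_nhds
    exact ((Real.continuousAt_rpow_const 1 (em n) (Or.inl one_ne_zero)).mul continuousAt_const)
  rw [Real.one_rpow, one_mul] at hlim
  refine le_of_tendsto hlim ?_
  have : ∀ᶠ t in 𝓝[<] (1:ℝ), t ∈ Ioo (0:ℝ) 1 := Ioo_mem_nhdsLT (by norm_num)
  filter_upwards [this] with t ht
  exact key t ht.1 ht.2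

theorem IsSol.not_const (hn : 7 ≤ n) {u : E → ℝ} (h : IsSol u) (hc : ∀ a b, u a ≤ u b) : False := by
  have hu : u = fun _ => u 0 := funext fun x => le_antisymm (hc _ _) (hc _ _)
  have h1 := h.eqn 0
  have z1 : lap u = fun _ => 0 := by
    rw [hu]; funext x; simp [lap]
  have z2 : lap (fun _ : E => (0:ℝ)) = fun _ => 0 := by
    funext x; simp [lap]
  rw [z1, z2, z2] at h1
  have := cst_pos hn
  have := h.pos 0
  have : 0 < cst n * u 0 ^ pe n := by positivity
  rw [neg_zero] at h1
  linarith

theorem IsSol.symm (hn : 7 ≤ n) {u : E → ℝ} (h : IsSol u) (x : E) : ∃ l, Symm u x l := by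
  by_contra hx
  apply h.not_const hn
  apply const_of_allGood hn
  intro y
  rcases h.dich hn y with h1 | ⟨l, h1⟩
  · exact h1
  · rcases h.dich hn x with h2 | h2
    · exact (h2.not_symm hn h.smooth.continuous h.pos h1).elim
    · exact (hx h2).elim

end globalPart
end Bubble

open MeasureTheory Set Filter Topology
open scoped ContDiff
namespace Bubble

section finalPart
variable {n : ℕ}

local notation "E" => EuclideanSpace ℝ (Fin n)

/-- ratio of squared distances -/
def DD (x h : E) (t : ℝ) : ℝ := 1 - 2 * t * inner ℝ x h + t^2 * (‖x‖^2 * ‖h‖^2)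

theorem sym_rel {u : E → ℝ} {x : E} {l0 lx : ℝ} (h0 : Symm u 0 l0) (hx : Symm u x lx)
    {h : E} (hh : h ≠ 0) {t : ℝ} (ht : t ≠ 0) (hD : 0 < DD x h t) :
    l0 ^ em n * u (t • (l0^2 • h)) =
      lx ^ em n * (DD x h t ^ (-(em n / 2)) * u (x + (lx^2 / DD x h t) • (t • h - (t^2 * ‖h‖^2) • x))) := by
  set q : E := t • h with hq
  have hq0 : q ≠ 0 := smul_ne_zero ht hh
  have hqn : 0 < ‖q‖ := norm_pos_iff.2 hq0
  have hqq : ‖q‖^2 = t^2 * ‖h‖^2 := by rw [hq, norm_smul, mul_pow, Real.norm_eq_abs, sq_abs]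
  set z : E := (‖q‖^2)⁻¹ • q with hz
  have hzn : ‖z‖ = ‖q‖⁻¹ := by
    rw [hz, norm_smul, Real.norm_of_nonneg (by positivity)]; field_simp
  have hz0 : z ≠ 0 := norm_pos_iff.1 (by rw [hzn]; positivity)
  have hzx : ‖z - x‖^2 = DD x h t * (‖q‖⁻¹)^2 := by
    rw [norm_sub_sq_real, hzn, hz, hq, inner_smul_left, inner_smul_left, real_inner_comm, ← hq, DD]
    simp only [conj_trivial]
    have : t^2 * (‖x‖^2 * ‖h‖^2) = ‖x‖^2 * ‖q‖^2 := by rw [hqq]; ring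
    rw [this]
    field_simp
  have hzxp : 0 < ‖z - x‖ := by
    have : 0 < ‖z - x‖^2 := by rw [hzx]; positivity
    by_contra hc
    have h0' : ‖z - x‖ = 0 := le_antisymm (not_lt.1 hc) (norm_nonneg _)
    rw [h0'] at this
    norm_num at this
  have r0 := h0.2 z hz0
  have rx := hx.2 (z - x) (norm_pos_iff.1 hzxp)
  rw [add_zero, add_zero] at r0
  rw [sub_add_cancel] at rx
  have i0 : iv l0 z = t • (l0^2 • h) := by
    rw [iv, hzn, hz, smul_smul, smul_comm t, ← hq]
    congr 1
    field_simp
  have ix : iv lx (z - x) + x = x + (lx^2 / DD x h t) • (q - (t^2 * ‖h‖^2) • x) := by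
    rw [add_comm, iv, div_pow, hzx, ← hqq]
    congr 1
    have : q - ‖q‖^2 • x = ‖q‖^2 • (z - x) := by
      rw [smul_sub, hz, smul_smul, mul_inv_cancel₀ (by positivity), one_smul]
    rw [this, smul_smul]
    congr 1
    field_simp
  rw [i0] at r0
  rw [ix] at rx
  have e1 : ‖z - x‖ ^ em n = DD x h t ^ (em n / 2) * ‖z‖ ^ em n := by
    rw [show em n = 2 * (em n / 2) by ring, ← rpow_sq (norm_nonneg _), ← rpow_sq (norm_nonneg _), hzx, ← hzn,
      Real.mul_rpow hD.le (by positivity)]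
    congr 2; ring
  rw [← r0]
  have e2 : lx ^ em n * (DD x h t ^ (-(em n / 2)) * u (x + (lx^2 / DD x h t) • (q - (t^2 * ‖h‖^2) • x)))
    = DD x h t ^ (-(em n / 2)) * (‖z - x‖ ^ em n * u z) := by rw [rx]; ring
  rw [e2, e1, Real.rpow_neg hD.le]
  have : DD x h t ^ (em n / 2) ≠ 0 := by positivity
  field_simp

theorem sym_deriv {u : E → ℝ} (hu : ContDiff ℝ ∞ u) {x : E} {l0 lx : ℝ} (h0 : Symm u 0 l0) (hx : Symm u x lx)
    {h : E} (hh : h ≠ 0) :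
    l0 ^ em n * u 0 = lx ^ em n * u x ∧
    l0 ^ em n * (l0^2 * fderiv ℝ u 0 h) =
      lx ^ em n * (em n * inner ℝ x h * u x + lx^2 * fderiv ℝ u x h) := by
  have hd : Differentiable ℝ u := hu.differentiable (by simp)
  have D0 : DD x h 0 = 1 := by simp [DD]
  have dD : HasDerivAt (DD x h) (-2 * inner ℝ x h) 0 := by
    have a1 := (((hasDerivAt_id (0:ℝ)).const_mul 2).mul_const (inner ℝ x h))
    have a2 := ((hasDerivAt_id (0:ℝ)).pow 2).mul_const (‖x‖^2 * ‖h‖^2)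
    have := ((hasDerivAt_const (0:ℝ) (1:ℝ)).sub a1).add a2
    refine (this.congr_deriv ?_)
    simp
  -- left function
  have dF : HasDerivAt (fun t : ℝ => l0 ^ em n * u (t • (l0^2 • h))) (l0 ^ em n * (l0^2 * fderiv ℝ u 0 h)) 0 := by
    have b1 : HasDerivAt (fun t : ℝ => t • (l0^2 • h)) ((1:ℝ) • (l0^2 • h)) 0 := (hasDerivAt_id (0:ℝ)).smul_const _
    have b2 : HasFDerivAt u (fderiv ℝ u 0) ((0:ℝ) • (l0^2 • h)) := by rw [zero_smul]; exact (hd 0).hasFDerivAt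
    have := (b2.comp_hasDerivAt (0:ℝ) b1).const_mul (l0 ^ em n)
    refine this.congr_deriv ?_
    simp
  have dP : HasDerivAt (fun t : ℝ => x + (lx^2 / DD x h t) • (t • h - (t^2 * ‖h‖^2) • x)) (lx^2 • h) 0 := by
    have b1 : HasDerivAt (fun t : ℝ => t • h - (t^2 * ‖h‖^2) • x) h 0 := by
      have c1 := (hasDerivAt_id (0:ℝ)).smul_const h
      have c2 := (((hasDerivAt_id (0:ℝ)).pow 2).mul_const (‖h‖^2)).smul_const x
      refine (c1.sub c2).congr_deriv ?_
      simp
    have b2 := (hasDerivAt_const (0:ℝ) (lx^2)).div dD (by rw [D0]; exact one_ne_zero)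
    refine ((b2.smul b1).const_add x).congr_deriv ?_
    simp [D0]
  have dG : HasDerivAt (fun t : ℝ => lx ^ em n * (DD x h t ^ (-(em n / 2)) *
      u (x + (lx^2 / DD x h t) • (t • h - (t^2 * ‖h‖^2) • x))))
      (lx ^ em n * (em n * inner ℝ x h * u x + lx^2 * fderiv ℝ u x h)) 0 := by
    have b1 := dD.rpow_const (p := -(em n / 2)) (Or.inl (by rw [D0]; exact one_ne_zero))
    have b2 : HasFDerivAt u (fderiv ℝ u x) (x + (lx^2 / DD x h 0) • ((0:ℝ) • h - ((0:ℝ)^2 * ‖h‖^2) • x)) := by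
      simpa using (hd x).hasFDerivAt
    have b3 := b2.comp_hasDerivAt (0:ℝ) dP
    refine ((b1.mul b3).const_mul (lx ^ em n)).congr_deriv ?_
    simp [D0]
    left; left; ring
  have hev : ∀ᶠ t in 𝓝[≠] (0:ℝ), l0 ^ em n * u (t • (l0^2 • h)) = lx ^ em n * (DD x h t ^ (-(em n / 2)) *
      u (x + (lx^2 / DD x h t) • (t • h - (t^2 * ‖h‖^2) • x))) := by
    have : ∀ᶠ t in 𝓝 (0:ℝ), 0 < DD x h t := dD.continuousAt.eventually (lt_mem_nhds (by rw [D0]; exact one_pos))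
    filter_upwards [this.filter_mono nhdsWithin_le_nhds, self_mem_nhdsWithin] with t h1 h2
    exact sym_rel h0 hx hh h2 h1
  have hv : l0 ^ em n * u ((0:ℝ) • (l0^2 • h)) = lx ^ em n * (DD x h 0 ^ (-(em n / 2)) *
      u (x + (lx^2 / DD x h 0) • ((0:ℝ) • h - ((0:ℝ)^2 * ‖h‖^2) • x))) :=
    tendsto_nhds_unique_of_eventuallyEq (dF.continuousAt.tendsto.mono_left nhdsWithin_le_nhds)
      (dG.continuousAt.tendsto.mono_left nhdsWithin_le_nhds) hev
  have hev2 : (fun t : ℝ => l0 ^ em n * u (t • (l0^2 • h))) =ᶠ[𝓝 0] fun t => lx ^ em n * (DD x h t ^ (-(em n / 2)) *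
      u (x + (lx^2 / DD x h t) • (t • h - (t^2 * ‖h‖^2) • x))) := by
    rw [eventually_nhdsWithin_iff] at hev
    filter_upwards [hev] with t h1
    by_cases ht : t = 0
    · rw [ht]; exact hv
    · exact h1 ht
  refine ⟨by simpa [D0] using hv, ?_⟩
  exact dF.unique (dG.congr_of_eventuallyEq hev2)

theorem IsSol.form (hn : 7 ≤ n) {u : E → ℝ} (h : IsSol u) :
    ∃ (x0 : E) (a b : ℝ), 0 < a ∧ 0 < b ∧ ∀ x, u x = (a * ‖x - x0‖^2 + b) ^ (-(em n / 2)) := by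
  have hm := em_pos hn
  choose l hl using fun x => h.symm hn x
  have hlp : ∀ x, 0 < l x := fun x => (hl x).1
  have hd : Differentiable ℝ u := h.smooth.differentiable (by simp)
  haveI : Nontrivial E := by
    haveI : Nonempty (Fin n) := ⟨⟨0, by omega⟩⟩
    infer_instance
  set A : ℝ := l 0 ^ em n * u 0 with hA
  have hA0 : 0 < A := mul_pos (Real.rpow_pos_of_pos (hlp 0) _) (h.pos 0)
  have hval : ∀ x, l x ^ em n * u x = A := by
    intro x
    obtain ⟨v, hv⟩ := exists_ne (0:E)
    exact (sym_deriv h.smooth (hl 0) (hl x) hv).1.symm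
  set a : ℝ := A ^ (-2 / em n) with ha
  have ha0 : 0 < a := Real.rpow_pos_of_pos hA0 _
  set W : E → ℝ := fun x => u x ^ (-2 / em n) with hW
  have hWp : ∀ x, 0 < W x := fun x => Real.rpow_pos_of_pos (h.pos x) _
  -- l x ^ 2 = W x / a
  have hl2 : ∀ x, a * l x ^ 2 = W x := by
    intro x
    rw [ha, ← hval x, Real.mul_rpow (Real.rpow_pos_of_pos (hlp x) _).le (h.pos x).le, ← Real.rpow_mul (hlp x).le,
      mul_div_cancel₀ _ hm.ne', Real.rpow_neg (hlp x).le]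
    have := hlp x
    rw [Real.rpow_two]
    have e : u x ^ (-2 / em n) = W x := rfl
    rw [e]
    field_simp
  have hlm : ∀ x, l x ^ em n = A / u x := fun x => by
    rw [eq_div_iff (h.pos x).ne', hval]
  have hWd : ∀ x, HasFDerivAt W ((-2 / em n * (W x / u x)) • fderiv ℝ u x) x := by
    intro x
    have := (hd x).hasFDerivAt.rpow_const (p := -2 / em n) (Or.inl (h.pos x).ne')
    refine this.congr_fderiv ?_
    rw [Real.rpow_sub_one (h.pos x).ne']
  have hrel : ∀ x v, fderiv ℝ W x v = 2 * a * inner ℝ x v + fderiv ℝ W 0 v := by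
    intro x v
    by_cases hv : v = 0
    · simp [hv]
    have h2 := (sym_deriv h.smooth (hl 0) (hl x) hv).2
    rw [(hWd x).fderiv, (hWd 0).fderiv]
    simp only [smul_apply, smul_eq_mul]
    rw [hlm, hlm] at h2
    rw [← hl2, ← hl2]
    have := h.pos x
    have := h.pos 0
    field_simp
    field_simp at h2
    linear_combination h2
  set p : E := (InnerProductSpace.toDual ℝ E).symm (fderiv ℝ W 0) with hp
  have hpv : ∀ v, fderiv ℝ W 0 v = inner ℝ p v := fun v => by
    rw [hp, InnerProductSpace.toDual_symm_apply]
  set x0 : E := (-(2*a)⁻¹) • p with hx0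
  have hp' : p = -(2 * a) • x0 := by
    rw [hx0, smul_smul]
    have : -(2*a) * -(2*a)⁻¹ = 1 := by field_simp
    rw [this, one_smul]
  have hVd : ∀ x, HasFDerivAt (fun x => W x - a * ‖x - x0‖^2) (0 : E →L[ℝ] ℝ) x := by
    intro x
    have h1 := (hWd x).differentiableAt.hasFDerivAt
    have h2 := (hasFDerivAt_sq x0 x).const_mul a
    refine (h1.sub h2).congr_fderiv ?_
    ext v
    simp [hrel x v, hpv, hp', inner_sub_left, inner_smul_left]
    ring
  have hconst : ∀ x, W x - a * ‖x - x0‖^2 = W x0 := by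
    intro x
    have := is_const_of_fderiv_eq_zero (𝕜 := ℝ) (f := fun x => W x - a * ‖x - x0‖^2)
      (fun y => (hVd y).differentiableAt) (fun y => (hVd y).fderiv) x x0
    simpa using this
  refine ⟨x0, a, W x0, ha0, hWp x0, fun x => ?_⟩
  have e : a * ‖x - x0‖^2 + W x0 = W x := by rw [← hconst x]; ring
  rw [e, hW]
  simp only
  rw [← Real.rpow_mul (h.pos x).le]
  have : -2 / em n * -(em n / 2) = 1 := by field_simp
  rw [this, Real.rpow_one]

theorem IsSol.final (hn : 7 ≤ n) {u : E → ℝ} (h : IsSol u) :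
    ∃ (x0 : E) (e : ℝ), 0 < e ∧ ∀ x, u x = (2*e/(1+e^2*‖x-x0‖^2)) ^ (((n:ℝ)-6)/2) := by
  obtain ⟨x0, a, b, ha, hb, hu⟩ := h.form hn
  have hm := em_pos hn
  have hba : 0 < b / a := by positivity
  have key : 4 * a * b = 1 := by
    have h1 := h.eqn x0
    have hu' : u = fun y : E => (fun s => a ^ (-(em n / 2)) * (b / a + s) ^ (-(em n / 2))) (‖y - x0‖^2) := by
      funext y
      rw [hu]
      simp only
      rw [← Real.mul_rpow ha.le (by positivity)]
      congr 1
      field_simp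
      ring
    have hc : ContDiffOn ℝ ∞ (fun s => a ^ (-(em n / 2)) * (b / a + s) ^ (-(em n / 2))) (Ioi (-(b / a))) :=
      contDiffOn_const.mul contDiffOn_bub
    have h2 := congrFun (lap3_radial (by linarith : -(b/a) < 0) hc x0) x0
    rw [← hu'] at h2
    rw [Lop_const_mul, Lop_const_mul, Lop_const_mul] at h2
    have h3 := Lop3_bub (n := n) (ε := b / a) (‖x0 - x0‖^2) (by simp; linarith)
    simp only [em] at h2
    rw [h3] at h2
    rw [h2, hu x0] at h1
    simp only [sub_self, norm_zero, ne_eq, OfNat.ofNat_ne_zero, not_false_eq_true, zero_pow, mul_zero,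
      zero_add, add_zero] at h1
    rw [← Real.rpow_mul hb.le] at h1
    have e1 : -(em n / 2) * pe n = -(((n:ℝ)+6)/2) := by
      rw [← em_mul_pe hn]; ring
    rw [e1, show b = a * (b / a) by field_simp, Real.mul_rpow ha.le hba.le] at h1
    have e2 : a * (b / a) / a = b / a := by field_simp
    rw [e2] at h1
    have e3 : a ^ (-(((n:ℝ)-6)/2)) = a ^ (-(((n:ℝ)+6)/2)) * a ^ 6 := by
      rw [← Real.rpow_natCast, ← Real.rpow_add ha]; congr 1; push_cast; ring
    rw [e3] at h1
    have q1 : 0 < a ^ (-(((n:ℝ)+6)/2)) := by positivity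
    have q2 : 0 < (b/a) ^ (-(((n:ℝ)+6)/2)) := by positivity
    have q3 := cst_pos hn
    have e4 : (4 * a * b)^3 = 1 := by
      have : (cst n * a ^ (-(((n:ℝ)+6)/2)) * (b/a) ^ (-(((n:ℝ)+6)/2))) * (64 * (b/a)^3 * a^6)
        = (cst n * a ^ (-(((n:ℝ)+6)/2)) * (b/a) ^ (-(((n:ℝ)+6)/2))) * 1 := by linear_combination h1
      have := mul_left_cancel₀ (by positivity) this
      rw [← this]
      field_simp
      ring
    exact (pow_eq_one_iff_of_nonneg (by positivity) (by norm_num)).1 e4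
  refine ⟨x0, 2 * a, by positivity, fun x => ?_⟩
  rw [hu, Real.rpow_neg (by positivity), ← Real.inv_rpow (by positivity)]
  simp only [em]
  congr 1
  have : 0 < 1 + (2*a)^2 * ‖x - x0‖^2 := by positivity
  have : 0 < a * ‖x - x0‖^2 + b := by positivity
  rw [inv_eq_one_div, div_eq_div_iff (by positivity) (by positivity)]
  linear_combination -key

end finalPart
end Bubble

/-- Every smooth positive solution of (−Δ)³u = c_n·u^((n+6)/(n−6)) on all of ℝⁿ is a
standard bubble (2ε/(1+ε²|x−x₀|²))^((n−6)/2); in particular it is radially symmetric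
about some point x₀. -/
theorem classification_entire_solutions (n : ℕ) (hn : 7 ≤ n)
    (u : EuclideanSpace ℝ (Fin n) → ℝ) (hu : ContDiff ℝ (⊤ : ℕ∞) u)
    (hupos : ∀ x, 0 < u x)
    (hsol : ∀ x : EuclideanSpace ℝ (Fin n),
      -(lap (lap (lap u)) x) = cst n * u x ^ (((n:ℝ)+6)/((n:ℝ)-6))) :
    ∃ (x₀ : EuclideanSpace ℝ (Fin n)) (ε : ℝ), 0 < ε ∧
      (∀ x : EuclideanSpace ℝ (Fin n),
        u x = (2*ε/(1+ε^2*‖x-x₀‖^2)) ^ (((n:ℝ)-6)/2)) ∧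
      (∀ x y : EuclideanSpace ℝ (Fin n), ‖x - x₀‖ = ‖y - x₀‖ → u x = u y) := by
  have h : Bubble.IsSol u := ⟨hu, hupos, hsol⟩
  obtain ⟨x0, e, he, hx⟩ := h.final hn
  refine ⟨x0, e, he, hx, fun x y hxy => ?_⟩
  rw [hx x, hx y, hxy]
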